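/- Let G be a finitely generated free group of rank r with free generating set S, acting on a standard Borel probability space (X, μ) by μ-preserving Borel automorphisms. Suppose f_G(X, μ) is defined, the action is ergodic, and f_G(X, μ) > 0. Then the action is essentially free: μ({x ∈ X : g·x ≠ x for every 1_G ≠ g ∈ G}) = 1. -/

import Mathlib

open MeasureTheory Filter Set
open scoped ENNReal symmDiff Pointwise

namespace FPaper

/-- The free group of rank `r`; its free generating set `S` is `{FreeGroup.of i | i : Fin r}`. -/
abbrev FG (r : ℕ) := FreeGroup (Fin r)

/-- The reduced `S`-word length of a group element. -/
def wlen {r : ℕ} (g : FG r) : ℕ := g.toWord.length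

/-- The ball of radius `n` in `FG r` with respect to the word length. -/
def ball (r n : ℕ) : Set (FG r) := {g | wlen g ≤ n}

instance ballFinite (r n : ℕ) : Finite (ball r n) := by
  have h : ball r n ⊆ FreeGroup.mk '' {l : List (Fin r × Bool) | l.length ≤ n} :=
    fun g hg => ⟨g.toWord, hg, FreeGroup.mk_toWord⟩
  exact (((List.finite_length_le _ n).image _).subset h).to_subtype

/-- An action of a group `G` on a measurable space `X` by Borel automorphisms. -/
structure BorelAction (G : Type*) [Group G] (X : Type*) [MeasurableSpace X] where
  act : G → X → X
  act_one : ∀ x, act 1 x = x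
  act_mul : ∀ g h x, act (g * h) x = act g (act h x)
  measurable_act : ∀ g, Measurable (act g)

namespace BorelAction

variable {G X : Type*} [Group G] [mX : MeasurableSpace X]

/-- The action preserves the measure `μ`. -/
def Preserves (T : BorelAction G X) (μ : Measure X) : Prop :=
  ∀ g : G, MeasurePreserving (T.act g) μ μ

/-- The translated set `g · B`. -/
def smulSet (T : BorelAction G X) (g : G) (B : Set X) : Set X := T.act g⁻¹ ⁻¹' B

/-- The translated partition `g · α`, where a countable measurable partition is recorded
by a (measurable, countably-valued) function whose fibers are the cells. -/
def tr {I : Type*} (T : BorelAction G X) (g : G) (a : X → I) : X → I :=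
  fun x => a (T.act g⁻¹ x)

/-- The join `F · α = ⋁_{f ∈ F} f · α` of the translates of a partition over a set `F ⊆ G`. -/
def joinF {I : Type*} (T : BorelAction G X) (F : Set G) (a : X → I) : X → (F → I) :=
  fun x f => a (T.act (f : G)⁻¹ x)

/-- The σ-algebra generated by the partitions `f · α`, `f ∈ F`. -/
def partSA {I : Type*} (T : BorelAction G X) (F : Set G) (a : X → I) : MeasurableSpace X :=
  ⨆ f ∈ F, MeasurableSpace.comap (T.tr f a) ⊤

/-- The partition `a` is generating: the smallest `G`-invariant σ-algebra containing `a`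
(i.e. the one generated by all translates of `a`) contains every measurable set up to
`ν`-null sets. -/
def Generating {I : Type*} (T : BorelAction G X) (a : X → I) (ν : Measure X) : Prop :=
  ∀ B : Set X, MeasurableSet B →
    ∃ B', MeasurableSet[T.partSA Set.univ a] B' ∧ ν (B ∆ B') = 0


/-- Ergodicity of the action with respect to `ν`. -/
def IsErgodic (T : BorelAction G X) (ν : Measure X) : Prop :=
  ∀ B : Set X, MeasurableSet B → (∀ g : G, ν (T.smulSet g B ∆ B) = 0) → ν B = 0 ∨ ν B = 1

/-- The action is essentially free with respect to `ν`. -/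
def EssentiallyFree (T : BorelAction G X) (ν : Measure X) : Prop :=
  ν {x | ∀ g : G, g ≠ 1 → T.act g x ≠ x} = 1

/-- The stabilizer subgroup of a point. -/
def stab (T : BorelAction G X) (y : X) : Subgroup G where
  carrier := {g | T.act g y = y}
  one_mem' := T.act_one y
  mul_mem' := by
    intro g h hg hh
    simp only [Set.mem_setOf_eq] at *
    rw [T.act_mul, hh, hg]
  inv_mem' := by
    intro g hg
    simp only [Set.mem_setOf_eq] at *
    conv_lhs => rw [← hg]
    rw [← T.act_mul, inv_mul_cancel, T.act_one]

end BorelAction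

/-- `m` is a `G`-invariant sub-σ-algebra. -/
def InvariantSA {G X : Type*} [Group G] (m : MeasurableSpace X) [mX : MeasurableSpace X]
    (T : BorelAction G X) : Prop :=
  m ≤ mX ∧ ∀ (g : G) (B : Set X), MeasurableSet[m] B → MeasurableSet[m] (T.act g ⁻¹' B)

/-- A measure is purely atomic: the set of atoms has full measure. -/
def PurelyAtomic {X : Type*} [MeasurableSpace X] (ν : Measure X) : Prop :=
  ν {x | 0 < ν {x}} = 1

/-- Shannon entropy of a countable measurable partition (recorded as a countably-valued
function), with values in `[0, ∞]`. -/
noncomputable def Hpart {X I : Type*} [MeasurableSpace X] [Countable I]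
    (μ : Measure X) (a : X → I) : ℝ≥0∞ :=
  ∑' i : I, ENNReal.ofReal (Real.negMulLog (μ (a ⁻¹' {i})).toReal)

/-- Conditional Shannon entropy of a countable partition given a sub-σ-algebra `m`:
`H(α/m) = ∫ ∑_{A ∈ α} φ(E[1_A | m](x)) dμ(x)` with `φ(t) = -t log t`. -/
noncomputable def condEntS {X I : Type*} (m : MeasurableSpace X) [mX : MeasurableSpace X]
    [Countable I] (μ : Measure X) (a : X → I) : ℝ≥0∞ :=
  ∫⁻ x, ∑' i : I,
    ENNReal.ofReal (Real.negMulLog ((μ[(a ⁻¹' {i}).indicator (fun _ => (1:ℝ)) | m]) x)) ∂μ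

/-- Conditional Shannon entropy of a partition given another partition:
`H(α/β) = ∑_{B ∈ β} ∑_{A ∈ α} -μ(B) · (μ(A∩B)/μ(B)) · log (μ(A∩B)/μ(B))`
(equivalently `H(α ∨ β) − H(β)`), with values in `[0, ∞]`. -/
noncomputable def condEntP {X I J : Type*} [MeasurableSpace X] [Countable I] [Countable J]
    (μ : Measure X) (a : X → I) (b : X → J) : ℝ≥0∞ :=
  ∑' q : I × J, μ (b ⁻¹' {q.2}) *
    ENNReal.ofReal (Real.negMulLog
      ((μ (a ⁻¹' {q.1} ∩ b ⁻¹' {q.2})).toReal / (μ (b ⁻¹' {q.2})).toReal))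

/-- `F_G(X, μ, S, β) = (1-2r)·H(β) + ∑_{s ∈ S} H(s·β ∨ β)`. -/
noncomputable def FF {r : ℕ} {X I : Type*} [MeasurableSpace X] [Countable I]
    (μ : Measure X) (T : BorelAction (FG r) X) (b : X → I) : ℝ :=
  (1 - 2 * (r : ℝ)) * (Hpart μ b).toReal
    + ∑ i : Fin r, (Hpart μ (fun x => (T.tr (FreeGroup.of i) b x, b x))).toReal

/-- The sequence `n ↦ F_G(X, μ, S, B_n · α)`. -/
noncomputable def fSeq {r : ℕ} {X : Type*} [MeasurableSpace X]
    (μ : Measure X) (T : BorelAction (FG r) X) (a : X → ℕ) (n : ℕ) : ℝ :=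
  FF μ T (T.joinF (ball r n) a)

/-- The f-invariant entropy `f_G(X, μ) = lim_n F_G(X, μ, S, B_n·α)`, the limit (= infimum,
since the sequence is non-increasing) of the sequence `fSeq`, with values in `[-∞, ∞)`. -/
noncomputable def fInv {r : ℕ} {X : Type*} [MeasurableSpace X]
    (μ : Measure X) (T : BorelAction (FG r) X) (a : X → ℕ) : EReal :=
  ⨅ n : ℕ, ((fSeq μ T a n : ℝ) : EReal)

/-- Relative version `F_G(X, μ/Σ, S, β) = (1-2r)·H(β/Σ) + ∑_{s ∈ S} H(s·β ∨ β / Σ)`. -/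
noncomputable def FFrel {r : ℕ} {X I : Type*} (m : MeasurableSpace X) [mX : MeasurableSpace X]
    [Countable I] (μ : Measure X) (T : BorelAction (FG r) X) (b : X → I) : ℝ :=
  (1 - 2 * (r : ℝ)) * (condEntS m μ b).toReal
    + ∑ i : Fin r, (condEntS m μ (fun x => (T.tr (FreeGroup.of i) b x, b x))).toReal

/-- The sequence `n ↦ F_G(X, μ/Σ, S, B_n · α)`. -/
noncomputable def fSeqRel {r : ℕ} {X : Type*} (m : MeasurableSpace X) [mX : MeasurableSpace X]
    (μ : Measure X) (T : BorelAction (FG r) X) (a : X → ℕ) (n : ℕ) : ℝ :=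
  FFrel m μ T (T.joinF (ball r n) a)

/-- The relative f-invariant entropy `f_G(X, μ/Σ)`, with values in `[-∞, ∞)`. -/
noncomputable def fInvRel {r : ℕ} {X : Type*} (m : MeasurableSpace X) [mX : MeasurableSpace X]
    (μ : Measure X) (T : BorelAction (FG r) X) (a : X → ℕ) : EReal :=
  ⨅ n : ℕ, ((fSeqRel m μ T a n : ℝ) : EReal)

/-- A total order on `S ∪ S⁻¹` is recorded by an injection `ord : Fin r × Bool → ℕ`;
`g ≺ h` iff `|g| < |h|`, or `|g| = |h|` and the reduced word of `g` lexicographically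
precedes that of `h`. -/
def wlt {r : ℕ} (ord : Fin r × Bool → ℕ) (g h : FG r) : Prop :=
  wlen g < wlen h ∨ (wlen g = wlen h ∧ List.Lex (fun p q => ord p < ord q) g.toWord h.toWord)

/-- `Pre(g)`: the set of elements strictly preceding `g`. -/
def Pre {r : ℕ} (ord : Fin r × Bool → ℕ) (g : FG r) : Set (FG r) := {h | wlt ord h g}

/-- The generator or inverse generator corresponding to a letter. -/
def letter {r : ℕ} (p : Fin r × Bool) : FG r :=
  if p.2 then FreeGroup.of p.1 else (FreeGroup.of p.1)⁻¹

/-- The first (leftmost) letter of the reduced word of `g` (junk value `1` for `g = 1`). -/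
def firstLetter {r : ℕ} (g : FG r) : FG r := ((g.toWord.head?).map letter).getD 1

/-- The independence decay `δ(g, α/Σ)`, as a real number:
`δ(g, α/Σ) = H(s⁻¹g·α / Pre(s⁻¹g)·α ∨ Σ) − H(g·α / Pre(g)·α ∨ Σ)` where `s` is the first
letter of `g`. -/
noncomputable def idecay {r : ℕ} {X I : Type*} (m : MeasurableSpace X) [mX : MeasurableSpace X]
    [Countable I] (μ : Measure X) (T : BorelAction (FG r) X)
    (ord : Fin r × Bool → ℕ) (a : X → I) (g : FG r) : ℝ :=
  (condEntS (m ⊔ T.partSA (Pre ord ((firstLetter g)⁻¹ * g)) a) μ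
      (T.tr ((firstLetter g)⁻¹ * g) a)).toReal
  - (condEntS (m ⊔ T.partSA (Pre ord g) a) μ (T.tr g a)).toReal

/-- The entropy `H(τ)` of a probability space: the supremum of the Shannon entropies of
finite measurable partitions. -/
noncomputable def measEnt {M : Type*} [MeasurableSpace M] (τ : Measure M) : ℝ≥0∞ :=
  ⨆ (P : Finset (Set M)) (_ : ∀ p ∈ P, MeasurableSet p)
    (_ : (P : Set (Set M)).PairwiseDisjoint id) (_ : ⋃₀ (P : Set (Set M)) = Set.univ),
    ∑ p ∈ P, ENNReal.ofReal (Real.negMulLog (τ p).toReal)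

/-- The non-negative part of an extended real, in `ℝ≥0∞`. -/
noncomputable def erealToENNReal (x : EReal) : ℝ≥0∞ :=
  if x = ⊤ then ⊤ else ENNReal.ofReal x.toReal

/-- The integral of an `EReal`-valued function (positive part minus negative part),
with values in `[-∞, ∞]`. -/
noncomputable def eIntegral {M : Type*} [MeasurableSpace M] (τ : Measure M) (f : M → EReal) :
    EReal :=
  ((∫⁻ m, erealToENNReal (f m) ∂τ : ℝ≥0∞) : EReal)
    - ((∫⁻ m, erealToENNReal (-(f m)) ∂τ : ℝ≥0∞) : EReal)

/-- The set of `G`-invariant Borel probability measures on `X`. -/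
def InvProb {G X : Type*} [Group G] [MeasurableSpace X] (T : BorelAction G X) :
    Set (Measure X) :=
  {ν | IsProbabilityMeasure ν ∧ ∀ g : G, MeasurePreserving (T.act g) ν ν}


section Entropy

set_option linter.unusedSectionVars false

variable {X I J K : Type*} [MeasurableSpace X]
  [Countable I] [MeasurableSpace I] [MeasurableSingletonClass I]
  [Countable J] [MeasurableSpace J] [MeasurableSingletonClass J]
  [Countable K] [MeasurableSpace K] [MeasurableSingletonClass K]
  {μ : Measure X} [IsProbabilityMeasure μ]

/-- The information function of a partition, whose integral is the Shannon entropy. -/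
noncomputable def info (μ : Measure X) (a : X → I) (x : X) : ℝ≥0∞ :=
  ENNReal.ofReal (-Real.log (μ (a ⁻¹' {a x})).toReal)

theorem lintegral_comp_eq_tsum {a : X → I} (ha : Measurable a) (f : I → ℝ≥0∞) :
    ∫⁻ x, f (a x) ∂μ = ∑' i, f i * μ (a ⁻¹' {i}) := by
  rw [← lintegral_map (Measurable.of_discrete (f := f)) ha, lintegral_countable']
  exact tsum_congr fun i => by rw [Measure.map_apply ha (measurableSet_singleton i)]

theorem measurable_info {a : X → I} (ha : Measurable a) : Measurable (info μ a) :=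
  (Measurable.of_discrete
    (f := fun i => ENNReal.ofReal (-Real.log (μ (a ⁻¹' {i})).toReal))).comp ha

theorem Hpart_eq_lintegral {a : X → I} (ha : Measurable a) :
    Hpart μ a = ∫⁻ x, info μ a x ∂μ := by
  have := lintegral_comp_eq_tsum (μ := μ) ha
    (fun i => ENNReal.ofReal (-Real.log (μ (a ⁻¹' {i})).toReal))
  simp only [info]
  rw [this, Hpart]
  refine tsum_congr fun i => ?_
  have hfin : μ (a ⁻¹' {i}) ≠ ⊤ := measure_ne_top _ _
  conv_rhs => rw [← ENNReal.ofReal_toReal hfin, ENNReal.toReal_ofReal ENNReal.toReal_nonneg]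
  rw [← ENNReal.ofReal_mul' ENNReal.toReal_nonneg, Real.negMulLog]
  congr 1
  ring

theorem ae_measure_fiber_pos (a : X → I) :
    ∀ᵐ x ∂μ, 0 < μ (a ⁻¹' {a x}) := by
  have h : ∀ i, ∀ᵐ x ∂μ, a x = i → 0 < μ (a ⁻¹' {i}) := by
    intro i
    by_cases hi : μ (a ⁻¹' {i}) = 0
    · filter_upwards [measure_eq_zero_iff_ae_notMem.1 hi] with x hx hxi
      exact absurd hxi hx
    · exact .of_forall fun x _ => pos_iff_ne_zero.2 hi
  filter_upwards [ae_all_iff.2 h] with x hx using hx _ rfl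

theorem info_le_info {a : X → I} {b : X → J} (h : b.FactorsThrough a) {x : X}
    (hx : 0 < μ (a ⁻¹' {a x})) : info μ b x ≤ info μ a x := by
  refine ENNReal.ofReal_le_ofReal (neg_le_neg (Real.log_le_log ?_ ?_))
  · exact ENNReal.toReal_pos hx.ne' (measure_ne_top _ _)
  · exact ENNReal.toReal_mono (measure_ne_top _ _) (measure_mono fun y hy => h hy)

/-- Entropy decreases when the partition is coarsened. -/
theorem Hpart_le_of_factorsThrough {a : X → I} {b : X → J} (ha : Measurable a)
    (hb : Measurable b) (h : b.FactorsThrough a) : Hpart μ b ≤ Hpart μ a := by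
  rw [Hpart_eq_lintegral ha, Hpart_eq_lintegral hb]
  refine lintegral_mono_ae ?_
  filter_upwards [ae_measure_fiber_pos (μ := μ) a] with x hx using info_le_info h hx

theorem Hpart_comp {a : X → I} {T : X → X} (hT : MeasurePreserving T μ μ)
    (ha : ∀ i, MeasurableSet (a ⁻¹' {i})) : Hpart μ (a ∘ T) = Hpart μ a := by
  refine tsum_congr fun i => ?_
  rw [preimage_comp, hT.measure_preimage (ha i).nullMeasurableSet]

theorem tsum_measure_fiber {a : X → I} (ha : Measurable a) {B : Set X} (hB : MeasurableSet B) :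
    ∑' i, μ (a ⁻¹' {i} ∩ B) = μ B := by
  rw [← measure_iUnion]
  · congr 1
    ext x
    simp
  · intro i j hij
    refine Disjoint.mono inter_subset_left inter_subset_left ?_
    exact Disjoint.preimage _ (by simpa using hij)
  · exact fun i => (ha (measurableSet_singleton i)).inter hB

theorem lintegral_ratio_le_one {a : X → I} {b : X → J} {c : X → K} (ha : Measurable a)
    (hb : Measurable b) (hc : Measurable c) :
    ∫⁻ x, μ (a ⁻¹' {a x} ∩ c ⁻¹' {c x}) * μ (b ⁻¹' {b x} ∩ c ⁻¹' {c x})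
      / (μ ((fun y => (c y, a y, b y)) ⁻¹' {(c x, a x, b x)}) * μ (c ⁻¹' {c x})) ∂μ ≤ 1 := by
  have hw : Measurable fun y => (c y, a y, b y) := hc.prodMk (ha.prodMk hb)
  have := lintegral_comp_eq_tsum (μ := μ) hw (fun w =>
    μ (a ⁻¹' {w.2.1} ∩ c ⁻¹' {w.1}) * μ (b ⁻¹' {w.2.2} ∩ c ⁻¹' {w.1})
      / (μ ((fun y => (c y, a y, b y)) ⁻¹' {w}) * μ (c ⁻¹' {w.1})))
  rw [this]
  calc _ ≤ ∑' w : K × I × J, μ (a ⁻¹' {w.2.1} ∩ c ⁻¹' {w.1}) *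
        (μ (b ⁻¹' {w.2.2} ∩ c ⁻¹' {w.1}) * (μ (c ⁻¹' {w.1}))⁻¹) := by
        refine ENNReal.tsum_le_tsum fun w => ?_
        set p := μ ((fun y => (c y, a y, b y)) ⁻¹' {w})
        by_cases hp : p = 0
        · simp [hp]
        · have hp' : p ≠ ⊤ := measure_ne_top _ _
          rw [ENNReal.div_eq_inv_mul, ENNReal.mul_inv (.inl hp) (.inl hp')]
          apply le_of_eq
          calc _ = (p⁻¹ * p) * (μ (a ⁻¹' {w.2.1} ∩ c ⁻¹' {w.1}) *
              (μ (b ⁻¹' {w.2.2} ∩ c ⁻¹' {w.1}) * (μ (c ⁻¹' {w.1}))⁻¹)) := by ring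
            _ = _ := by rw [ENNReal.inv_mul_cancel hp hp', one_mul]
    _ = ∑' k, μ (c ⁻¹' {k}) * (μ (c ⁻¹' {k}) * (μ (c ⁻¹' {k}))⁻¹) := by
        rw [ENNReal.tsum_prod']
        refine tsum_congr fun k => ?_
        have hk : MeasurableSet (c ⁻¹' {k}) := hc (measurableSet_singleton k)
        rw [ENNReal.tsum_prod']
        simp only [ENNReal.tsum_mul_left, ENNReal.tsum_mul_right, tsum_measure_fiber hb hk,
          tsum_measure_fiber ha hk]
    _ ≤ ∑' k, μ (c ⁻¹' {k} ∩ univ) := by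
        refine ENNReal.tsum_le_tsum fun k => ?_
        rw [inter_univ]
        exact mul_le_of_le_one_right' (ENNReal.mul_inv_le_one _)
    _ = 1 := by rw [tsum_measure_fiber hc .univ, measure_univ]

/-- Strong subadditivity of Shannon entropy. -/
theorem Hpart_strong_subadditive {a : X → I} {b : X → J} {c : X → K} (ha : Measurable a)
    (hb : Measurable b) (hc : Measurable c) :
    Hpart μ (fun x => (c x, a x, b x)) + Hpart μ c
      ≤ Hpart μ (fun x => (a x, c x)) + Hpart μ (fun x => (b x, c x)) := by
  have hw : Measurable fun y => (c y, a y, b y) := hc.prodMk (ha.prodMk hb)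
  have hac : Measurable fun y => (a y, c y) := ha.prodMk hc
  have hbc : Measurable fun y => (b y, c y) := hb.prodMk hc
  rw [← ENNReal.add_le_add_iff_right (a := 1) ENNReal.one_ne_top, Hpart_eq_lintegral hw,
    Hpart_eq_lintegral hc, Hpart_eq_lintegral hac, Hpart_eq_lintegral hbc]
  rw [← lintegral_add_left (measurable_info hw), ← lintegral_add_left (measurable_info hac)]
  calc _ = ∫⁻ x, (info μ (fun y => (c y, a y, b y)) x + info μ c x + 1) ∂μ := by
        rw [lintegral_add_right _ measurable_const]
        simp
    _ ≤ ∫⁻ x, ((info μ (fun y => (a y, c y)) x + info μ (fun y => (b y, c y)) x) +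
        μ (a ⁻¹' {a x} ∩ c ⁻¹' {c x}) * μ (b ⁻¹' {b x} ∩ c ⁻¹' {c x})
        / (μ ((fun y => (c y, a y, b y)) ⁻¹' {(c x, a x, b x)}) * μ (c ⁻¹' {c x}))) ∂μ := by
        refine lintegral_mono_ae ?_
        filter_upwards [ae_measure_fiber_pos (μ := μ) fun y => (c y, a y, b y)] with x hx
        have e1 : (fun y => (a y, c y)) ⁻¹' {(a x, c x)} = a ⁻¹' {a x} ∩ c ⁻¹' {c x} := by
          ext y; simp
        have e2 : (fun y => (b y, c y)) ⁻¹' {(b x, c x)} = b ⁻¹' {b x} ∩ c ⁻¹' {c x} := by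
          ext y; simp
        simp only [info, e1, e2]
        set p := μ ((fun y => (c y, a y, b y)) ⁻¹' {(c x, a x, b x)}) with hp
        set q := μ (c ⁻¹' {c x}) with hq
        set s := μ (a ⁻¹' {a x} ∩ c ⁻¹' {c x}) with hs
        set t := μ (b ⁻¹' {b x} ∩ c ⁻¹' {c x}) with ht
        have hpq : p ≤ q := measure_mono fun y hy => by simp at hy ⊢; tauto
        have hps : p ≤ s := measure_mono fun y hy => by simp at hy ⊢; tauto
        have hpt : p ≤ t := measure_mono fun y hy => by simp at hy ⊢; tauto
        have pos : ∀ {v : ℝ≥0∞}, p ≤ v → v ≤ 1 → 0 < v.toReal ∧ 0 ≤ -Real.log v.toReal := by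
          intro v hv hv1
          have h1 : v.toReal ≤ 1 := ENNReal.toReal_le_of_le_ofReal zero_le_one (by simpa)
          exact ⟨ENNReal.toReal_pos (hx.trans_le hv).ne' (hv1.trans_lt ENNReal.one_lt_top).ne,
            neg_nonneg.2 (Real.log_nonpos ENNReal.toReal_nonneg h1)⟩
        obtain ⟨p0, pl⟩ := pos le_rfl prob_le_one
        obtain ⟨q0, ql⟩ := pos hpq prob_le_one
        obtain ⟨s0, sl⟩ := pos hps prob_le_one
        obtain ⟨t0, tl⟩ := pos hpt prob_le_one
        have hratio : s * t / (p * q) =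
            ENNReal.ofReal (s.toReal * t.toReal / (p.toReal * q.toReal)) := by
          rw [← ENNReal.toReal_mul, ← ENNReal.toReal_mul, ← ENNReal.toReal_div,
            ENNReal.ofReal_toReal]
          refine ENNReal.div_ne_top (ENNReal.mul_ne_top (measure_ne_top _ _)
            (measure_ne_top _ _)) (mul_ne_zero hx.ne' (hx.trans_le hpq).ne')
        rw [hratio, ← ENNReal.ofReal_one, ← ENNReal.ofReal_add pl ql,
          ← ENNReal.ofReal_add (by positivity) zero_le_one, ← ENNReal.ofReal_add sl tl,
          ← ENNReal.ofReal_add (by positivity) (by positivity)]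
        refine ENNReal.ofReal_le_ofReal ?_
        have := Real.log_le_sub_one_of_pos
          (show 0 < s.toReal * t.toReal / (p.toReal * q.toReal) by positivity)
        rw [Real.log_div (by positivity) (by positivity), Real.log_mul s0.ne' t0.ne',
          Real.log_mul p0.ne' q0.ne'] at this
        linarith
    _ ≤ _ := by
        have hm : Measurable fun x =>
            info μ (fun y => (a y, c y)) x + info μ (fun y => (b y, c y)) x :=
          (measurable_info hac).add (measurable_info hbc)
        rw [lintegral_add_left hm]
        gcongr
        exact lintegral_ratio_le_one ha hb hc

/-- Subadditivity of Shannon entropy. -/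
theorem Hpart_prod_le {a : X → I} {b : X → J} (ha : Measurable a) (hb : Measurable b) :
    Hpart μ (fun x => (a x, b x)) ≤ Hpart μ a + Hpart μ b := by
  have hc : Measurable fun _ : X => () := measurable_const
  have h := Hpart_strong_subadditive (μ := μ) ha hb hc
  calc _ ≤ Hpart μ (fun x => ((), a x, b x)) :=
        Hpart_le_of_factorsThrough (hc.prodMk (ha.prodMk hb)) (ha.prodMk hb)
          fun x y hxy => by simpa using hxy
    _ ≤ _ := le_self_add
    _ ≤ _ := h
    _ ≤ _ := by
        gcongr
        · exact Hpart_le_of_factorsThrough ha (ha.prodMk hc) fun x y hxy => by simpa using hxy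
        · exact Hpart_le_of_factorsThrough hb (hb.prodMk hc) fun x y hxy => by simpa using hxy

end Entropy


section Words

variable {r : ℕ}

/-- The letter inverse to `t`. -/
def invLetter (t : Fin r × Bool) : Fin r × Bool := (t.1, !t.2)

theorem mk_invLetter (t : Fin r × Bool) : FreeGroup.mk [invLetter t] = (FreeGroup.mk [t])⁻¹ := by
  simp [invLetter, FreeGroup.inv_mk, FreeGroup.invRev]

theorem mk_cons (t : Fin r × Bool) (L : List (Fin r × Bool)) :
    FreeGroup.mk (t :: L) = FreeGroup.mk [t] * FreeGroup.mk L := by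
  rw [FreeGroup.mul_mk]; rfl

theorem isReduced_cons_cons {s t : Fin r × Bool} {L : List (Fin r × Bool)} :
    FreeGroup.IsReduced (s :: t :: L) ↔ t ≠ invLetter s ∧ FreeGroup.IsReduced (t :: L) := by
  rw [FreeGroup.isReduced_cons_cons]
  obtain ⟨i, b⟩ := s
  obtain ⟨j, c⟩ := t
  refine and_congr_left fun _ => ?_
  simp only [invLetter, ne_eq, Prod.mk.injEq, not_and]
  constructor
  · rintro h rfl
    have := h rfl
    cases b <;> cases c <;> simp_all
  · rintro h rfl
    have := h rfl
    cases b <;> cases c <;> simp_all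

theorem isReduced_tail {s : Fin r × Bool} {L : List (Fin r × Bool)}
    (h : FreeGroup.IsReduced (s :: L)) : FreeGroup.IsReduced L :=
  h.infix (List.suffix_cons s L).isInfix

theorem toWord_mk_of_isReduced {L : List (Fin r × Bool)} (h : FreeGroup.IsReduced L) :
    (FreeGroup.mk L).toWord = L := by
  rw [FreeGroup.toWord_mk, h.reduce_eq]

/-- Left multiplication by a letter either prepends it or cancels the first letter. -/
theorem toWord_letter_mul (t : Fin r × Bool) (q : FG r) :
    (FreeGroup.mk [t] * q).toWord = t :: q.toWord ∨
      q.toWord = invLetter t :: (FreeGroup.mk [t] * q).toWord := by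
  have hq : FreeGroup.IsReduced q.toWord := FreeGroup.isReduced_toWord
  have hmul : FreeGroup.mk [t] * q = FreeGroup.mk (t :: q.toWord) := by
    rw [mk_cons t q.toWord, FreeGroup.mk_toWord]
  rw [hmul]
  rcases hw : q.toWord with _ | ⟨u, W⟩
  · left
    exact toWord_mk_of_isReduced (by simp)
  · rw [hw] at hq
    by_cases hu : u = invLetter t
    · right
      subst hu
      rw [mk_cons t, mk_cons _ W, mk_invLetter, mul_inv_cancel_left,
        toWord_mk_of_isReduced (isReduced_tail hq)]
    · left
      exact toWord_mk_of_isReduced (isReduced_cons_cons.2 ⟨hu, hq⟩)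

theorem wlen_mk_le (L : List (Fin r × Bool)) : wlen (FreeGroup.mk L) ≤ L.length :=
  FreeGroup.norm_mk_le

theorem wlen_letter_mul_le (t : Fin r × Bool) (q : FG r) :
    wlen (FreeGroup.mk [t] * q) ≤ wlen q + 1 := by
  rcases toWord_letter_mul t q with h | h <;>
    · have := congrArg List.length h
      simp only [wlen, List.length_cons] at this ⊢
      omega

end Words

section FunctionalF

variable {r : ℕ}

/-- The properties of `C ↦ H(C · α)` used below. -/
structure IsInvariantSubmodular (e : Finset (FG r) → ℝ) : Prop where
  empty : e ∅ = 0
  mono : ∀ {C D : Finset (FG r)}, C ⊆ D → e C ≤ e D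
  submodular : ∀ C D : Finset (FG r), e (C ∪ D) + e (C ∩ D) ≤ e C + e D
  smul : ∀ (g : FG r) (C : Finset (FG r)), e (g • C) = e C

/-- The functional `e(C) - ∑ e(sC ∩ C)`, an upper bound for `F_G` on balls. -/
noncomputable def edgeDefect (e : Finset (FG r) → ℝ) (C : Finset (FG r)) : ℝ :=
  e C - ∑ i : Fin r, e ((FreeGroup.of i • C) ∩ C)

variable {e : Finset (FG r) → ℝ}

namespace IsInvariantSubmodular

theorem insert_sub_antitone (he : IsInvariantSubmodular e) (h : FG r) {Y C : Finset (FG r)} (hYC : Y ⊆ C) :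
    e (insert h C) - e C ≤ e (insert h Y) - e Y := by
  have h1 := he.submodular C (insert h Y)
  have h2 : C ∪ insert h Y = insert h C := by
    ext x
    simp only [Finset.mem_union, Finset.mem_insert]
    have := @hYC x
    tauto
  have h3 : e Y ≤ e (C ∩ insert h Y) :=
    he.mono (Finset.subset_inter hYC (Finset.subset_insert _ _))
  rw [h2] at h1
  linarith

theorem nonneg (he : IsInvariantSubmodular e)
    (C : Finset (FG r)) : 0 ≤ e C := he.empty ▸ he.mono (Finset.empty_subset C)

theorem edgeDefect_le (he : IsInvariantSubmodular e) (C : Finset (FG r)) : edgeDefect e C ≤ e C :=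
  sub_le_self _ (Finset.sum_nonneg fun _ _ => he.nonneg _)

theorem edgeDefect_insert_le (he : IsInvariantSubmodular e) (t : Fin r × Bool) {h : FG r} {C : Finset (FG r)}
    (hh : h ∈ FreeGroup.mk [t] • C) :
    edgeDefect e (insert h C) ≤ edgeDefect e C + (e (insert h C) - e C)
      - (e (insert h (C ∩ FreeGroup.mk [t] • C)) - e (C ∩ FreeGroup.mk [t] • C)) := by
  obtain ⟨i, b⟩ := t
  set Y := C ∩ FreeGroup.mk [(i, b)] • C with hY
  have key : e (insert h Y) - e Y ≤
      e ((FreeGroup.of i • insert h C) ∩ insert h C) - e ((FreeGroup.of i • C) ∩ C) := by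
    cases b with
    | true =>
      have h1 : (FreeGroup.of i • C) ∩ C = Y := Finset.inter_comm _ _
      rw [h1]
      refine sub_le_sub_right (he.mono ?_) _
      intro x hx
      rw [Finset.mem_insert] at hx
      rcases hx with rfl | hx
      · exact Finset.mem_inter.2 ⟨Finset.smul_finset_subset_smul_finset
          (Finset.subset_insert _ _) hh, Finset.mem_insert_self _ _⟩
      · rw [← h1] at hx
        exact Finset.inter_subset_inter (Finset.smul_finset_subset_smul_finset
          (Finset.subset_insert _ _)) (Finset.subset_insert _ _) hx
    | false =>
      have hinv : FreeGroup.mk [(i, false)] = (FreeGroup.of i)⁻¹ := mk_invLetter (i, true)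
      have h1 : FreeGroup.of i • Y = (FreeGroup.of i • C) ∩ C := by
        rw [hY, Finset.smul_finset_inter, hinv, smul_inv_smul]
      rw [← h1, he.smul, ← he.smul (FreeGroup.of i) (insert h Y)]
      refine sub_le_sub_right (he.mono ?_) _
      rw [Finset.smul_finset_insert, h1]
      intro x hx
      rw [Finset.mem_insert] at hx
      rcases hx with rfl | hx
      · refine Finset.mem_inter.2 ⟨Finset.smul_mem_smul_finset (Finset.mem_insert_self _ _), ?_⟩
        rw [hinv, Finset.mem_inv_smul_finset_iff] at hh
        exact Finset.mem_insert_of_mem hh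
      · exact Finset.inter_subset_inter (Finset.smul_finset_subset_smul_finset
          (Finset.subset_insert _ _)) (Finset.subset_insert _ _) hx
  have hsum : e (insert h Y) - e Y ≤ ∑ j : Fin r,
      (e ((FreeGroup.of j • insert h C) ∩ insert h C) - e ((FreeGroup.of j • C) ∩ C)) := by
    refine key.trans (Finset.single_le_sum (f := fun j : Fin r =>
      e ((FreeGroup.of j • insert h C) ∩ insert h C) - e ((FreeGroup.of j • C) ∩ C))
      (fun j _ => sub_nonneg.2 (he.mono ?_)) (Finset.mem_univ i))
    exact Finset.inter_subset_inter (Finset.smul_finset_subset_smul_finset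
      (Finset.subset_insert _ _)) (Finset.subset_insert _ _)
  rw [Finset.sum_sub_distrib] at hsum
  unfold edgeDefect
  linarith

theorem edgeDefect_le_of_tails (he : IsInvariantSubmodular e) {C D : Finset (FG r)} (hCD : C ⊆ D)
    (htail : ∀ d ∈ D, d ∉ C → ∃ t, ∃ q ∈ D, d = FreeGroup.mk [t] * q ∧ wlen q < wlen d) :
    edgeDefect e D ≤ edgeDefect e C := by
  induction hn : (D \ C).card generalizing D with
  | zero =>
    rw [Finset.card_eq_zero, Finset.sdiff_eq_empty_iff_subset] at hn
    rw [hCD.antisymm hn]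
  | succ n ih =>
    obtain ⟨d, hd, hmax⟩ := (D \ C).exists_max_image wlen
      (Finset.card_pos.1 (by omega))
    rw [Finset.mem_sdiff] at hd
    have hsub : C ⊆ D.erase d := fun x hx =>
      Finset.mem_erase.2 ⟨fun hxd => hd.2 (hxd ▸ hx), hCD hx⟩
    have hcard : (D.erase d \ C).card = n := by
      rw [Finset.erase_sdiff_comm, Finset.card_erase_of_mem (Finset.mem_sdiff.2 hd), hn]
      rfl
    have hrec := ih hsub (fun x hx hxC => by
      obtain ⟨t, q, hq, hxq, hlt⟩ := htail x (Finset.mem_of_mem_erase hx) hxC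
      refine ⟨t, q, Finset.mem_erase.2 ⟨?_, hq⟩, hxq, hlt⟩
      rintro rfl
      have := hmax x (Finset.mem_sdiff.2 ⟨Finset.mem_of_mem_erase hx, hxC⟩)
      omega) hcard
    obtain ⟨t, q, hq, hdq, hlt⟩ := htail d hd.1 hd.2
    have hmem : d ∈ FreeGroup.mk [t] • D.erase d := by
      have hq' : q ∈ D.erase d := Finset.mem_erase.2 ⟨fun h => hlt.ne (congrArg wlen h), hq⟩
      have := Finset.smul_mem_smul_finset (a := FreeGroup.mk [t]) hq'
      rwa [smul_eq_mul, ← hdq] at this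
    have h1 := he.edgeDefect_insert_le t hmem
    have h2 := he.insert_sub_antitone d
      (Finset.inter_subset_left (s₁ := D.erase d) (s₂ := FreeGroup.mk [t] • D.erase d))
    rw [Finset.insert_erase hd.1] at h1 h2
    linarith

end IsInvariantSubmodular

end FunctionalF

section Window

variable {r : ℕ}

/-- A finite set of group elements attached to a word `L` such that `f_G` is bounded by the
entropy of `α` translated by `L` conditioned on the translates over the window. -/
def window : List (Fin r × Bool) → Finset (FG r)
  | [] => ∅
  | s :: L => insert (FreeGroup.mk L) (window L) ∪
      (Finset.univ.filter fun t => t ≠ invLetter s).biUnion fun t => FreeGroup.mk [t] • window L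

theorem mem_window_cons {s : Fin r × Bool} {L : List (Fin r × Bool)} {x : FG r} :
    x ∈ window (s :: L) ↔ x = FreeGroup.mk L ∨ x ∈ window L ∨
      ∃ t, t ≠ invLetter s ∧ ∃ y ∈ window L, FreeGroup.mk [t] * y = x := by
  simp [window, Finset.mem_smul_finset]

theorem window_subset_cons (s : Fin r × Bool) (L : List (Fin r × Bool)) :
    window L ⊆ window (s :: L) := fun _ hx => mem_window_cons.2 (.inr (.inl hx))

theorem mk_mem_window_cons (s : Fin r × Bool) (L : List (Fin r × Bool)) :
    FreeGroup.mk L ∈ window (s :: L) := mem_window_cons.2 (.inl rfl)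

theorem wlen_lt_of_mem_window {L : List (Fin r × Bool)} {x : FG r} (hx : x ∈ window L) :
    wlen x < L.length := by
  induction L generalizing x with
  | nil => simp [window] at hx
  | cons s L ih =>
    rw [List.length_cons]
    rcases mem_window_cons.1 hx with rfl | hx | ⟨t, -, y, hy, rfl⟩
    · exact Nat.lt_succ_of_le (wlen_mk_le L)
    · exact (ih hx).trans (Nat.lt_succ_self _)
    · have := wlen_letter_mul_le t y
      have := ih hy
      omega

theorem tail_mem_window {L : List (Fin r × Bool)} (hL : FreeGroup.IsReduced L) {x : FG r}
    {t : Fin r × Bool} {W : List (Fin r × Bool)}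
    (hx : x ∈ insert (FreeGroup.mk L) (window L)) (hW : x.toWord = t :: W) :
    FreeGroup.mk W ∈ window L := by
  induction L generalizing x t W with
  | nil =>
    rw [Finset.mem_insert] at hx
    rcases hx with rfl | hx
    · rw [toWord_mk_of_isReduced hL] at hW
      cases hW
    · simp [window] at hx
  | cons s L ih =>
    have hL' := isReduced_tail hL
    have ih' : ∀ {x : FG r} {t W}, x ∈ window L → x.toWord = t :: W →
        FreeGroup.mk W ∈ window L := fun hx hW => ih hL' (Finset.mem_insert_of_mem hx) hW
    rw [Finset.mem_insert, mem_window_cons] at hx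
    rcases hx with rfl | rfl | hx | ⟨u, -, y, hy, rfl⟩
    · rw [toWord_mk_of_isReduced hL] at hW
      cases hW
      exact mk_mem_window_cons s L
    · exact window_subset_cons s L (ih hL' (Finset.mem_insert_self _ _) hW)
    · exact window_subset_cons s L (ih' hx hW)
    · refine window_subset_cons s L ?_
      rcases toWord_letter_mul u y with h | h
      · rw [h] at hW
        cases hW
        rwa [FreeGroup.mk_toWord]
      · have h1 := ih' hy h
        rw [FreeGroup.mk_toWord] at h1
        exact ih' h1 hW

theorem mem_window_of_toWord_eq {L : List (Fin r × Bool)} (hL : FreeGroup.IsReduced L)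
    {x y : FG r} {t : Fin r × Bool} (hy : y ∈ insert (FreeGroup.mk L) (window L))
    (h : y.toWord = t :: x.toWord) : x ∈ window L := by
  simpa [FreeGroup.mk_toWord] using tail_mem_window hL hy h

theorem mem_window_of_mem_cons {s : Fin r × Bool} {L : List (Fin r × Bool)}
    (hL : FreeGroup.IsReduced (s :: L)) {q : FG r} (hq : q ∈ window (s :: L))
    (hsq : FreeGroup.mk [s] * q ∈ window (s :: L)) : q ∈ window L := by
  have hL' := isReduced_tail hL
  rcases mem_window_cons.1 hq with rfl | hq | ⟨t, hts, y, hy, rfl⟩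
  · rw [← mk_cons] at hsq
    have := wlen_lt_of_mem_window hsq
    rw [wlen, toWord_mk_of_isReduced hL] at this
    exact absurd this (lt_irrefl _)
  · exact hq
  · rcases toWord_letter_mul t y with h | h
    · have hs : (FreeGroup.mk [s] * (FreeGroup.mk [t] * y)).toWord =
          s :: (FreeGroup.mk [t] * y).toWord := by
        refine (toWord_letter_mul s _).resolve_right fun h' => hts ?_
        rw [h] at h'
        exact (List.cons.inj h').1
      rcases mem_window_cons.1 hsq with h1 | h1 | ⟨u, -, z, hz, hzs⟩
      · exact mem_window_of_toWord_eq hL' (h1 ▸ Finset.mem_insert_self _ _) hs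
      · exact mem_window_of_toWord_eq hL' (Finset.mem_insert_of_mem h1) hs
      · rcases toWord_letter_mul u z with hu | hu
        · rw [hzs, hs] at hu
          rw [FreeGroup.toWord_injective (List.cons.inj hu).2]
          exact hz
        · rw [hzs] at hu
          have h1 := mem_window_of_toWord_eq hL' (Finset.mem_insert_of_mem hz) hu
          exact mem_window_of_toWord_eq hL' (Finset.mem_insert_of_mem h1) hs
    · exact mem_window_of_toWord_eq hL' (Finset.mem_insert_of_mem hy) h

theorem edgeDefect_insert_window_le {e : Finset (FG r) → ℝ} (he : IsInvariantSubmodular e)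
    {L : List (Fin r × Bool)} (hL : FreeGroup.IsReduced L) :
    edgeDefect e (insert (FreeGroup.mk L) (window L)) ≤
      e (insert (FreeGroup.mk L) (window L)) - e (window L) := by
  induction L with
  | nil =>
    have h : e (window ([] : List (Fin r × Bool))) = 0 := he.empty
    rw [h, sub_zero]
    exact he.edgeDefect_le _
  | cons s L ih =>
    have hL' := isReduced_tail hL
    set C := window (s :: L)
    set h := FreeGroup.mk (s :: L)
    have hh : h ∈ FreeGroup.mk [s] • C := by
      have := Finset.smul_mem_smul_finset (a := FreeGroup.mk [s]) (mk_mem_window_cons s L)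
      rwa [smul_eq_mul, ← mk_cons] at this
    have hsub : insert (FreeGroup.mk L) (window L) ⊆ C :=
      Finset.insert_subset (mk_mem_window_cons s L) (window_subset_cons s L)
    have h1 : edgeDefect e C ≤ edgeDefect e (insert (FreeGroup.mk L) (window L)) := by
      refine he.edgeDefect_le_of_tails hsub fun d hd hdC => ?_
      rw [Finset.mem_insert, not_or] at hdC
      rcases mem_window_cons.1 hd with hd | hd | ⟨t, -, y, hy, rfl⟩
      · exact absurd hd hdC.1
      · exact absurd hd hdC.2
      · refine ⟨t, y, window_subset_cons s L hy, rfl, ?_⟩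
        rcases toWord_letter_mul t y with h | h
        · simp [wlen, h]
        · exact absurd (mem_window_of_toWord_eq hL' (Finset.mem_insert_of_mem hy) h) hdC.2
    have h2 := ih hL'
    have h3 := he.edgeDefect_insert_le s hh
    have hY : C ∩ FreeGroup.mk [s] • C ⊆ FreeGroup.mk [s] • window L := by
      intro x hx
      obtain ⟨hxC, hx⟩ := Finset.mem_inter.1 hx
      obtain ⟨q, hq, rfl⟩ := Finset.mem_smul_finset.1 hx
      exact Finset.smul_mem_smul_finset (mem_window_of_mem_cons hL hq hxC)
    have h4 := he.insert_sub_antitone h hY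
    have h5 : insert h (FreeGroup.mk [s] • window L) =
        FreeGroup.mk [s] • insert (FreeGroup.mk L) (window L) := by
      rw [Finset.smul_finset_insert, smul_eq_mul, ← mk_cons]
    rw [h5, he.smul, he.smul] at h4
    linarith

theorem one_mem_insert_window (L : List (Fin r × Bool)) :
    1 ∈ insert (FreeGroup.mk L) (window L) := by
  induction L with
  | nil => exact Finset.mem_insert_self _ _
  | cons s L ih =>
    refine Finset.mem_insert_of_mem ?_
    exact Finset.insert_subset (mk_mem_window_cons s L) (window_subset_cons s L) ih

theorem one_mem_window {L : List (Fin r × Bool)} (hL : L ≠ []) : (1 : FG r) ∈ window L := by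
  obtain ⟨s, L, rfl⟩ := List.exists_cons_of_ne_nil hL
  exact Finset.insert_subset (mk_mem_window_cons s L) (window_subset_cons s L)
    (one_mem_insert_window L)

theorem window_subset_append (M L : List (Fin r × Bool)) : window L ⊆ window (M ++ L) := by
  induction M with
  | nil => rfl
  | cons s M ih => exact ih.trans (window_subset_cons s _)

theorem mk_mem_window_append {M : List (Fin r × Bool)} (hM : M ≠ []) (L : List (Fin r × Bool)) :
    FreeGroup.mk L ∈ window (M ++ L) := by
  induction M with
  | nil => exact absurd rfl hM
  | cons s M ih =>
    rcases eq_or_ne M [] with rfl | hM'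
    · exact mk_mem_window_cons s L
    · exact window_subset_cons s _ (ih hM')

theorem mk_mul_mem_window_append {M L : List (Fin r × Bool)} (hML : FreeGroup.IsReduced (M ++ L))
    {x : FG r} (hx : x ∈ window L) : FreeGroup.mk M * x ∈ window (M ++ L) := by
  induction M with
  | nil => simpa [← FreeGroup.one_eq_mk] using hx
  | cons s M ih =>
    rw [mk_cons, mul_assoc]
    refine mem_window_cons.2 (.inr (.inr ⟨s, ?_, _, ih (isReduced_tail hML), rfl⟩))
    intro h
    have := congrArg Prod.snd h
    simp [invLetter] at this

/-- The ball of radius `n` as a finite set. -/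
noncomputable def ballFinset (r n : ℕ) : Finset (FG r) := (Set.toFinite (ball r n)).toFinset

@[simp]
theorem mem_ballFinset {n : ℕ} {x : FG r} : x ∈ ballFinset r n ↔ wlen x ≤ n := by
  simp [ballFinset, ball]

theorem edgeDefect_ballFinset_le {e : Finset (FG r) → ℝ} (he : IsInvariantSubmodular e)
    {L : List (Fin r × Bool)} (hL : FreeGroup.IsReduced L) :
    edgeDefect e (ballFinset r L.length) ≤
      e (insert (FreeGroup.mk L) (window L)) - e (window L) := by
  refine le_trans (he.edgeDefect_le_of_tails ?_ ?_) (edgeDefect_insert_window_le he hL)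
  · intro x hx
    rw [mem_ballFinset]
    rcases Finset.mem_insert.1 hx with rfl | hx
    · exact wlen_mk_le L
    · exact (wlen_lt_of_mem_window hx).le
  · intro d hd hdC
    rcases hw : d.toWord with _ | ⟨t, W⟩
    · rw [FreeGroup.toWord_eq_nil_iff] at hw
      exact absurd (hw ▸ one_mem_insert_window L) hdC
    · have hW : (FreeGroup.mk W).toWord = W :=
        toWord_mk_of_isReduced (isReduced_tail (hw ▸ FreeGroup.isReduced_toWord))
      have hlen : wlen (FreeGroup.mk W) < wlen d := by simp [wlen, hw, hW]
      refine ⟨t, FreeGroup.mk W, ?_, ?_, hlen⟩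
      · rw [mem_ballFinset] at hd ⊢
        omega
      · rw [← mk_cons, ← hw, FreeGroup.mk_toWord]

/-- The alternating word of length `2n + 1` in two letters. -/
def altWord (p q : Fin r × Bool) : ℕ → List (Fin r × Bool)
  | 0 => [q]
  | n + 1 => q :: p :: altWord p q n

theorem altWord_ne_nil (p q : Fin r × Bool) (n : ℕ) : ∃ L, altWord p q n = q :: L := by
  cases n with
  | zero => exact ⟨_, rfl⟩
  | succ n => exact ⟨_, rfl⟩

theorem isReduced_altWord {p q : Fin r × Bool} (hpq : p.1 ≠ q.1) (n : ℕ) :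
    FreeGroup.IsReduced (altWord p q n) := by
  induction n with
  | zero => simp [altWord]
  | succ n ih =>
    obtain ⟨L, hL⟩ := altWord_ne_nil p q n
    rw [altWord, isReduced_cons_cons]
    rw [hL] at ih ⊢
    rw [isReduced_cons_cons]
    refine ⟨fun h => ?_, fun h => ?_, ih⟩
    · have := congrArg Prod.fst h
      exact hpq this
    · have := congrArg Prod.fst h
      exact hpq this.symm

theorem ballFinset_subset_window_altWord {p q : Fin r × Bool} (hpq : p.1 ≠ q.1) (n : ℕ) :
    ballFinset r n ⊆ window (altWord p q n) := by
  induction n with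
  | zero =>
    intro x hx
    rw [mem_ballFinset, Nat.le_zero, wlen, List.length_eq_zero_iff,
      FreeGroup.toWord_eq_nil_iff] at hx
    exact hx ▸ mk_mem_window_cons q []
  | succ n ih =>
    intro x hx
    rw [mem_ballFinset] at hx
    rcases hw : x.toWord with _ | ⟨t, W⟩
    · rw [FreeGroup.toWord_eq_nil_iff] at hw
      exact hw ▸ one_mem_window (by simp [altWord])
    · have hW : (FreeGroup.mk W).toWord = W :=
        toWord_mk_of_isReduced (isReduced_tail (hw ▸ FreeGroup.isReduced_toWord))
      have hx' : FreeGroup.mk W ∈ window (altWord p q n) := by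
        apply ih
        rw [mem_ballFinset]
        simp only [wlen, hW, hw, List.length_cons] at hx ⊢
        omega
      have hxW : FreeGroup.mk [t] * FreeGroup.mk W = x := by
        rw [← mk_cons, ← hw, FreeGroup.mk_toWord]
      by_cases ht : t = invLetter q
      · refine window_subset_cons _ _ (mem_window_cons.2 (.inr (.inr ⟨t, ?_, _, hx', hxW⟩)))
        rintro h
        have := congrArg Prod.fst (h.symm.trans ht)
        exact hpq this
      · exact mem_window_cons.2 (.inr (.inr ⟨t, ht, _, window_subset_cons _ _ hx', hxW⟩))

end Window

section EntropyOfWindows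

variable {r : ℕ} {X : Type*} [MeasurableSpace X] {T : BorelAction (FG r) X} {a : X → ℕ}

theorem joinF_eq_iff {F : Set (FG r)} {x y : X} :
    T.joinF F a x = T.joinF F a y ↔ ∀ f ∈ F, a (T.act f⁻¹ x) = a (T.act f⁻¹ y) :=
  ⟨fun h f hf => congrFun h ⟨f, hf⟩, fun h => funext fun f => h f f.2⟩

theorem measurable_joinF (ha : Measurable a) (F : Set (FG r)) : Measurable (T.joinF F a) :=
  measurable_pi_iff.2 fun _ => ha.comp (T.measurable_act _)

/-- The Shannon entropy of the join of the translates of `α` over a finite set. -/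
noncomputable def windowEnt (μ : Measure X) (T : BorelAction (FG r) X) (a : X → ℕ)
    (C : Finset (FG r)) : ℝ :=
  (Hpart μ (T.joinF (C : Set (FG r)) a)).toReal

variable {μ : Measure X} [IsProbabilityMeasure μ]

theorem Hpart_const (c : ℕ) : Hpart μ (fun _ : X => c) = 0 := by
  refine ENNReal.tsum_eq_zero.2 fun i => ?_
  by_cases h : c = i <;> simp [h]

theorem Hpart_joinF_lt_top (hT : T.Preserves μ) (ha : Measurable a) (hfin : Hpart μ a < ⊤)
    (C : Finset (FG r)) : Hpart μ (T.joinF (C : Set (FG r)) a) < ⊤ := by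
  induction C using Finset.induction_on with
  | empty =>
    refine lt_of_le_of_lt (Hpart_le_of_factorsThrough (a := fun _ : X => 0) measurable_const
      (measurable_joinF ha _) fun x y _ => ?_)
      ((Hpart_const (μ := μ) 0).trans_lt ENNReal.zero_lt_top)
    exact funext fun f => absurd f.2 (by simp)
  | insert c C _ ih =>
    have hc : Measurable (a ∘ T.act c⁻¹) := ha.comp (T.measurable_act _)
    have hC : Measurable (T.joinF (C : Set (FG r)) a) := measurable_joinF ha _
    calc _ ≤ Hpart μ fun x => ((a ∘ T.act c⁻¹) x, T.joinF (C : Set (FG r)) a x) := by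
          refine Hpart_le_of_factorsThrough (hc.prodMk hC) (measurable_joinF ha _) ?_
          intro x y hxy
          rw [Prod.mk.injEq, joinF_eq_iff] at hxy
          rw [joinF_eq_iff]
          intro f hf
          rcases Finset.mem_insert.1 (Finset.mem_coe.1 hf) with rfl | hf
          · exact hxy.1
          · exact hxy.2 f hf
      _ ≤ Hpart μ (a ∘ T.act c⁻¹) + Hpart μ (T.joinF (C : Set (FG r)) a) := Hpart_prod_le hc hC
      _ < ⊤ := by
          rw [Hpart_comp (hT _) fun i => ha (measurableSet_singleton i)]
          exact ENNReal.add_lt_top.2 ⟨hfin, ih⟩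

theorem isInvariantSubmodular_windowEnt (hT : T.Preserves μ) (ha : Measurable a)
    (hfin : Hpart μ a < ⊤) : IsInvariantSubmodular (windowEnt μ T a) where
  empty := by
    have h : Hpart μ (T.joinF ((∅ : Finset (FG r)) : Set (FG r)) a) ≤ 0 := by
      rw [← Hpart_const (μ := μ) 0]
      refine Hpart_le_of_factorsThrough measurable_const (measurable_joinF ha _) fun x y _ => ?_
      exact funext fun f => absurd f.2 (by simp)
    rw [windowEnt, nonpos_iff_eq_zero.1 h, ENNReal.toReal_zero]
  mono := fun {C D} h => by
    refine ENNReal.toReal_mono (Hpart_joinF_lt_top hT ha hfin D).ne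
      (Hpart_le_of_factorsThrough (measurable_joinF ha _) (measurable_joinF ha _) ?_)
    intro x y hxy
    rw [joinF_eq_iff] at hxy ⊢
    exact fun f hf => hxy f (h hf)
  submodular := fun C D => by
    have hlt := Hpart_joinF_lt_top hT ha hfin
    have hm := measurable_joinF (T := T) ha
    simp only [windowEnt]
    rw [← ENNReal.toReal_add (hlt _).ne (hlt _).ne, ← ENNReal.toReal_add (hlt _).ne (hlt _).ne]
    refine ENNReal.toReal_mono (ENNReal.add_lt_top.2 ⟨hlt _, hlt _⟩).ne ?_
    have hsub := Hpart_strong_subadditive (μ := μ) (hm C) (hm D) (hm ↑(C ∩ D))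
    refine le_trans ?_ (hsub.trans ?_)
    · gcongr
      refine Hpart_le_of_factorsThrough ((hm _).prodMk ((hm _).prodMk (hm _))) (hm _) ?_
      intro x y hxy
      simp only [Prod.mk.injEq, joinF_eq_iff] at hxy ⊢
      intro f hf
      rcases Finset.mem_union.1 (Finset.mem_coe.1 hf) with hf | hf
      · exact hxy.2.1 f hf
      · exact hxy.2.2 f hf
    · gcongr
      · refine Hpart_le_of_factorsThrough (hm _) ((hm _).prodMk (hm _)) ?_
        intro x y hxy
        simp only [Prod.mk.injEq, joinF_eq_iff] at hxy ⊢
        exact ⟨hxy, fun f hf => hxy f (Finset.mem_inter.1 (Finset.mem_coe.1 hf)).1⟩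
      · refine Hpart_le_of_factorsThrough (hm _) ((hm _).prodMk (hm _)) ?_
        intro x y hxy
        simp only [Prod.mk.injEq, joinF_eq_iff] at hxy ⊢
        exact ⟨hxy, fun f hf => hxy f (Finset.mem_inter.1 (Finset.mem_coe.1 hf)).2⟩
  smul := fun g C => by
    have hm := measurable_joinF (T := T) ha
    have h : ∀ x y, T.joinF ((g • C : Finset (FG r)) : Set (FG r)) a x =
        T.joinF ((g • C : Finset (FG r)) : Set (FG r)) a y ↔
        (T.joinF (C : Set (FG r)) a ∘ T.act g⁻¹) x =
        (T.joinF (C : Set (FG r)) a ∘ T.act g⁻¹) y := by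
      intro x y
      simp only [Function.comp_apply, joinF_eq_iff, ← T.act_mul, ← mul_inv_rev,
        Finset.coe_smul_finset, Set.mem_smul_set, forall_exists_index, and_imp,
        forall_apply_eq_imp_iff₂, smul_eq_mul]
    have hc := (hm (C : Set (FG r))).comp (T.measurable_act g⁻¹)
    rw [windowEnt, windowEnt, ← Hpart_comp (hT g⁻¹) fun i => hm C (measurableSet_singleton i)]
    congr 1
    exact le_antisymm
      (Hpart_le_of_factorsThrough hc (hm _) fun x y hxy => (h x y).2 hxy)
      (Hpart_le_of_factorsThrough (hm _) hc fun x y hxy => (h x y).1 hxy)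

theorem fSeq_le_edgeDefect (hT : T.Preserves μ) (ha : Measurable a) (hfin : Hpart μ a < ⊤)
    (n : ℕ) : fSeq μ T a n ≤ edgeDefect (windowEnt μ T a) (ballFinset r n) := by
  have he := isInvariantSubmodular_windowEnt hT ha hfin
  have hlt := Hpart_joinF_lt_top hT ha hfin
  have hm := measurable_joinF (T := T) ha
  set B := ballFinset r n with hB
  have hBn : ball r n = (B : Set (FG r)) := by simp [hB, ballFinset]
  have hball : (Hpart μ (T.joinF (ball r n) a)).toReal = windowEnt μ T a B := by
    rw [windowEnt]
    congr 1
    refine le_antisymm (Hpart_le_of_factorsThrough (hm _) (hm _) fun x y hxy => ?_)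
      (Hpart_le_of_factorsThrough (hm _) (hm _) fun x y hxy => ?_) <;>
    · rw [joinF_eq_iff] at hxy ⊢
      rwa [hBn] at *
  have hpair : ∀ i : Fin r,
      (Hpart μ fun x => (T.tr (FreeGroup.of i) (T.joinF (ball r n) a) x,
        T.joinF (ball r n) a x)).toReal ≤
      2 * windowEnt μ T a B - windowEnt μ T a ((FreeGroup.of i • B) ∩ B) := by
    intro i
    have h1 := he.submodular (FreeGroup.of i • B) B
    rw [he.smul] at h1
    have h2 : (Hpart μ fun x => (T.tr (FreeGroup.of i) (T.joinF (ball r n) a) x,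
        T.joinF (ball r n) a x)).toReal ≤ windowEnt μ T a ((FreeGroup.of i • B) ∪ B) := by
      refine ENNReal.toReal_mono (hlt _).ne (Hpart_le_of_factorsThrough (hm _)
        (((hm _).comp (T.measurable_act _)).prodMk (hm _)) ?_)
      intro x y hxy
      rw [joinF_eq_iff] at hxy
      simp only [BorelAction.tr, Prod.mk.injEq, joinF_eq_iff, hBn]
      refine ⟨fun f hf => ?_, fun f hf => hxy f (by simp [Finset.mem_coe.1 hf])⟩
      have := hxy (FreeGroup.of i * f) (Finset.mem_coe.2 (Finset.mem_union_left _
        (Finset.smul_mem_smul_finset (Finset.mem_coe.1 hf))))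
      rwa [mul_inv_rev, T.act_mul, T.act_mul] at this
    linarith
  calc fSeq μ T a n ≤ (1 - 2 * (r : ℝ)) * windowEnt μ T a B + ∑ i : Fin r,
        (2 * windowEnt μ T a B - windowEnt μ T a ((FreeGroup.of i • B) ∩ B)) := by
        rw [fSeq, FF, hball]
        gcongr with i _
        exact hpair i
    _ = edgeDefect (windowEnt μ T a) B := by
        rw [Finset.sum_sub_distrib, edgeDefect]
        simp only [Finset.sum_const, Finset.card_univ, Fintype.card_fin, nsmul_eq_mul]
        ring

/-- The names seen at `x` through the window of the word `L`. -/
def windowName (T : BorelAction (FG r) X) (a : X → ℕ) (L : List (Fin r × Bool)) :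
    X → (↥(window L : Set (FG r)) → ℕ) :=
  T.joinF (window L : Set (FG r)) a ∘ T.act (FreeGroup.mk L)

/-- If the names in a window together with a partition `c` determine `a`, then the f-invariant
entropy is at most the entropy of `c`. -/
theorem fInv_le_Hpart (hT : T.Preserves μ) (ha : Measurable a) (hfin : Hpart μ a < ⊤)
    {L : List (Fin r × Bool)} (hL : FreeGroup.IsReduced L) {c : X → ℕ} (hc : Measurable c)
    (hac : a.FactorsThrough fun x => (windowName T a L x, c x)) :
    fInv μ T a ≤ (Hpart μ c : EReal) := by
  have he := isInvariantSubmodular_windowEnt hT ha hfin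
  have hlt := Hpart_joinF_lt_top hT ha hfin
  have hm := measurable_joinF (T := T) ha
  rcases eq_or_ne (Hpart μ c) ⊤ with htop | htop
  · rw [htop]
    exact le_top
  set g := FreeGroup.mk L with hg
  have hwm : Measurable (windowName T a L) := (hm _).comp (T.measurable_act _)
  have hH : windowEnt μ T a (insert g (window L)) ≤
      windowEnt μ T a (window L) + (Hpart μ c).toReal := by
    rw [windowEnt, windowEnt, ← ENNReal.toReal_add (hlt _).ne htop]
    refine ENNReal.toReal_mono (ENNReal.add_lt_top.2 ⟨hlt _, htop.lt_top⟩).ne ?_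
    rw [← Hpart_comp (hT g) fun i => hm _ (measurableSet_singleton i),
      ← Hpart_comp (hT g) fun i => hm (window L) (measurableSet_singleton i)]
    refine le_trans (Hpart_le_of_factorsThrough (hwm.prodMk hc)
      ((hm _).comp (T.measurable_act _)) ?_) (Hpart_prod_le hwm hc)
    intro x y hxy
    have hxya := hac hxy
    simp only [Prod.mk.injEq, windowName, Function.comp_apply, joinF_eq_iff] at hxy ⊢
    intro f hf
    rcases Finset.mem_insert.1 (Finset.mem_coe.1 hf) with rfl | hf
    · simpa only [← T.act_mul, inv_mul_cancel, T.act_one] using hxya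
    · exact hxy.1 f hf
  have h1 := (fSeq_le_edgeDefect hT ha hfin L.length).trans (edgeDefect_ballFinset_le he hL)
  refine (iInf_le _ L.length).trans ?_
  rw [← EReal.coe_toReal (x := ((Hpart μ c : ℝ≥0∞) : EReal)) (by simpa using htop) (by simp),
    EReal.coe_le_coe_iff, EReal.toReal_coe_ennreal]
  linarith

end EntropyOfWindows

section ErrorEntropy

set_option linter.unusedSectionVars false

variable {X : Type*} [MeasurableSpace X] {μ : Measure X} [IsProbabilityMeasure μ] {a : X → ℕ}

theorem negMulLog_le_of_le {t u : ℝ} (ht : 0 ≤ t) (htu : t ≤ u) (hu : u ≤ 1) :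
    Real.negMulLog t ≤ Real.negMulLog u + u := by
  rcases ht.eq_or_lt with rfl | ht
  · rw [Real.negMulLog_zero]
    exact add_nonneg (Real.negMulLog_nonneg htu hu) htu
  · have hu0 : 0 < u := ht.trans_le htu
    have h1 := Real.log_le_sub_one_of_pos (div_pos hu0 ht)
    rw [Real.log_div hu0.ne' ht.ne'] at h1
    have h2 : t * (Real.log u - Real.log t) ≤ u - t := by
      calc _ ≤ t * (u / t - 1) := by gcongr
        _ = u - t := by field_simp
    have h3 := Real.log_nonpos hu0.le hu
    simp only [Real.negMulLog]
    nlinarith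

open Classical in
/-- The partition recording the value of `a` on `D` and nothing off `D`. -/
noncomputable def errorPart (a : X → ℕ) (D : Set X) (x : X) : ℕ := if x ∈ D then a x + 1 else 0

theorem measurable_errorPart (ha : Measurable a) {D : Set X} (hD : MeasurableSet D) :
    Measurable (errorPart a D) :=
  Measurable.ite hD (ha.add_const 1) measurable_const

theorem errorPart_preimage_zero (a : X → ℕ) (D : Set X) : errorPart a D ⁻¹' {0} = Dᶜ := by
  ext x
  simp [errorPart]

theorem errorPart_preimage_succ (a : X → ℕ) (D : Set X) (k : ℕ) :
    errorPart a D ⁻¹' {k + 1} = a ⁻¹' {k} ∩ D := by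
  ext x
  by_cases h : x ∈ D <;> simp [errorPart, h]

theorem tendsto_Hpart_errorPart (ha : Measurable a) (hfin : Hpart μ a < ⊤) {D : ℕ → Set X}
    (hD : ∀ n, MeasurableSet (D n)) (hlim : Tendsto (fun n => μ (D n)) atTop (nhds 0)) :
    Tendsto (fun n => Hpart μ (errorPart a (D n))) atTop (nhds 0) := by
  let u : ℕ → ℝ
    | 0 => 1
    | k + 1 => (μ (a ⁻¹' {k})).toReal
  have hu : ∀ k, u k ≤ 1 := by
    rintro (_ | k)
    · exact le_rfl
    · exact ENNReal.toReal_le_of_le_ofReal zero_le_one (by rw [ENNReal.ofReal_one]; exact prob_le_one)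
  have hbound : ∀ n k, ENNReal.ofReal (Real.negMulLog (μ (errorPart a (D n) ⁻¹' {k})).toReal) ≤
      ENNReal.ofReal (Real.negMulLog (u k) + u k) := by
    intro n k
    refine ENNReal.ofReal_le_ofReal (negMulLog_le_of_le ENNReal.toReal_nonneg ?_ (hu k))
    cases k with
    | zero => exact ENNReal.toReal_le_of_le_ofReal zero_le_one (by rw [ENNReal.ofReal_one]; exact prob_le_one)
    | succ k =>
      rw [errorPart_preimage_succ]
      exact ENNReal.toReal_mono (measure_ne_top _ _) (measure_mono inter_subset_left)
  have hsum : ∑' k, ENNReal.ofReal (Real.negMulLog (u k) + u k) ≠ ⊤ := by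
    rw [tsum_eq_zero_add' ENNReal.summable]
    refine ENNReal.add_ne_top.2 ⟨ENNReal.ofReal_ne_top, ne_top_of_le_ne_top ?_
      (ENNReal.tsum_le_tsum fun k => ENNReal.ofReal_add_le)⟩
    rw [ENNReal.tsum_add]
    refine ENNReal.add_ne_top.2 ⟨hfin.ne, ?_⟩
    have h1 : ∀ k, ENNReal.ofReal (u (k + 1)) = μ (a ⁻¹' {k} ∩ univ) := fun k => by
      rw [inter_univ]
      exact ENNReal.ofReal_toReal (measure_ne_top _ _)
    simp only [h1, tsum_measure_fiber ha MeasurableSet.univ]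
    exact measure_ne_top _ _
  have hpt : ∀ k, Tendsto
      (fun n => ENNReal.ofReal (Real.negMulLog (μ (errorPart a (D n) ⁻¹' {k})).toReal))
      atTop (nhds 0) := by
    intro k
    have hcont : ∀ t : ℝ, Real.negMulLog t = 0 →
        Tendsto (fun n => (μ (errorPart a (D n) ⁻¹' {k})).toReal) atTop (nhds t) →
        Tendsto (fun n => ENNReal.ofReal (Real.negMulLog (μ (errorPart a (D n) ⁻¹' {k})).toReal))
          atTop (nhds 0) := by
      intro t ht h
      have := ENNReal.tendsto_ofReal ((Real.continuous_negMulLog.tendsto t).comp h)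
      rwa [ht, ENNReal.ofReal_zero] at this
    cases k with
    | zero =>
      refine hcont 1 Real.negMulLog_one ?_
      simp only [errorPart_preimage_zero, fun n => prob_compl_eq_one_sub (μ := μ) (hD n)]
      have := (ENNReal.tendsto_toReal (a := 1 - 0) (by simp)).comp
        (ENNReal.Tendsto.sub tendsto_const_nhds hlim (.inl ENNReal.one_ne_top))
      simpa [Function.comp_def] using this
    | succ k =>
      refine hcont 0 Real.negMulLog_zero ?_
      simp only [errorPart_preimage_succ]
      have := (ENNReal.tendsto_toReal ENNReal.zero_ne_top).comp
        (tendsto_of_tendsto_of_tendsto_of_le_of_le tendsto_const_nhds hlim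
          (fun n => zero_le (a := μ (a ⁻¹' {k} ∩ D n)))
          (fun n => measure_mono inter_subset_right))
      simpa [Function.comp_def] using this
  have := tendsto_lintegral_of_dominated_convergence (μ := Measure.count (α := ℕ))
    (F := fun n k => ENNReal.ofReal (Real.negMulLog (μ (errorPart a (D n) ⁻¹' {k})).toReal))
    (f := fun _ => 0) (fun k => ENNReal.ofReal (Real.negMulLog (u k) + u k))
    (fun n => Measurable.of_discrete) (fun n => .of_forall (hbound n))
    (by rwa [lintegral_count]) (.of_forall hpt)
  simpa [lintegral_count, Hpart] using this

end ErrorEntropy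

section Prediction

variable {r : ℕ} {X : Type*} [MeasurableSpace X] {T : BorelAction (FG r) X} {a : X → ℕ}
  {μ : Measure X} [IsProbabilityMeasure μ]

/-- If the values of `a` can be predicted from the names in windows of reduced words with
arbitrarily small error, then the f-invariant entropy is nonpositive. -/
theorem fInv_nonpos_of_predictable (hT : T.Preserves μ) (ha : Measurable a)
    (hfin : Hpart μ a < ⊤)
    (hpred : ∀ ε : ℝ≥0∞, 0 < ε → ∃ (L : List (Fin r × Bool)) (p : X → Option ℕ),
      FreeGroup.IsReduced L ∧ p.FactorsThrough (windowName T a L) ∧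
      MeasurableSet {x | p x ≠ some (a x)} ∧ μ {x | p x ≠ some (a x)} ≤ ε) :
    fInv μ T a ≤ 0 := by
  have hpos : ∀ n : ℕ, 0 < (((n : ℝ≥0∞) + 1)⁻¹) := fun n => by
    simp [ENNReal.add_eq_top]
  choose L p hL hp hD hμ using fun n : ℕ => hpred _ (hpos n)
  have hlim : Tendsto (fun n => μ {x | p n x ≠ some (a x)}) atTop (nhds 0) := by
    refine tendsto_of_tendsto_of_tendsto_of_le_of_le tendsto_const_nhds ?_ (fun n => zero_le) hμ
    have := (ENNReal.tendsto_inv_nat_nhds_zero).comp (tendsto_add_atTop_nat 1)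
    simpa [Function.comp_def] using this
  have h1 := tendsto_Hpart_errorPart (μ := μ) ha hfin hD hlim
  have h2 : Tendsto (fun n => (Hpart μ (errorPart a {x | p n x ≠ some (a x)}) : EReal)) atTop
      (nhds 0) := by
    have := (continuous_coe_ennreal_ereal.tendsto 0).comp h1
    simpa [Function.comp_def] using this
  refine ge_of_tendsto' h2 fun n => fInv_le_Hpart hT ha hfin (hL n)
    (measurable_errorPart ha (hD n)) ?_
  intro x y hxy
  rw [Prod.mk.injEq] at hxy
  have h3 := hp n hxy.1
  have h4 := hxy.2
  simp only [errorPart, Set.mem_ofPred_eq] at h4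
  by_cases hx : p n x = some (a x) <;> by_cases hy : p n y = some (a y) <;> simp [hx, hy] at h4
  · rw [h3, hy] at hx
    exact (Option.some.inj hx).symm
  · exact h4

end Prediction

section Approximation

variable {r : ℕ} {X : Type*} [mX : MeasurableSpace X] {T : BorelAction (FG r) X} {a : X → ℕ}

theorem measurableSet_of_factorsThrough {I : Type*} [Countable I] [MeasurableSpace I]
    [MeasurableSingletonClass I] {f : X → I} (hf : Measurable f) {B : Set X}
    (hB : ∀ x y, f x = f y → x ∈ B → y ∈ B) : MeasurableSet B := by
  have : B = f ⁻¹' (f '' B) := by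
    refine (subset_preimage_image f B).antisymm ?_
    rintro y ⟨x, hx, hxy⟩
    exact hB x y hxy hx
  rw [this]
  exact hf (Set.to_countable _).measurableSet

/-- Membership in `B` is determined by the names in the ball of radius `n`. -/
def IsBallDetermined (T : BorelAction (FG r) X) (a : X → ℕ) (n : ℕ) (B : Set X) : Prop :=
  ∀ x y, (∀ f, wlen f ≤ n → a (T.act f⁻¹ x) = a (T.act f⁻¹ y)) → x ∈ B → y ∈ B

theorem IsBallDetermined.mono {n m : ℕ} (hnm : n ≤ m) {B : Set X}
    (h : IsBallDetermined T a n B) : IsBallDetermined T a m B :=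
  fun x y hxy => h x y fun f hf => hxy f (hf.trans hnm)

theorem IsBallDetermined.measurableSet (ha : Measurable a) {n : ℕ} {B : Set X}
    (h : IsBallDetermined T a n B) : MeasurableSet B :=
  measurableSet_of_factorsThrough (measurable_joinF (T := T) ha (ball r n)) fun x y hxy =>
    h x y fun f hf => joinF_eq_iff.1 hxy f hf

theorem isSetRing_isBallDetermined (T : BorelAction (FG r) X) (a : X → ℕ) :
    IsSetRing {B | ∃ n, IsBallDetermined T a n B} where
  empty_mem := ⟨0, fun _ _ _ h => h⟩
  union_mem := by
    rintro B C ⟨n, hB⟩ ⟨m, hC⟩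
    refine ⟨max n m, fun x y hxy => Or.imp ?_ ?_⟩
    · exact hB.mono (le_max_left n m) x y hxy
    · exact hC.mono (le_max_right n m) x y hxy
  sdiff_mem := by
    rintro B C ⟨n, hB⟩ ⟨m, hC⟩
    refine ⟨max n m, fun x y hxy => And.imp ?_ (mt ?_)⟩
    · exact hB.mono (le_max_left n m) x y hxy
    · exact hC.mono (le_max_right n m) y x fun f hf => (hxy f hf).symm

/-- The σ-algebra generated by the sets determined by the names in some ball. -/
abbrev ballDeterminedSA (T : BorelAction (FG r) X) (a : X → ℕ) : MeasurableSpace X :=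
  MeasurableSpace.generateFrom {B | ∃ n, IsBallDetermined T a n B}

theorem partSA_le_ballDeterminedSA (T : BorelAction (FG r) X) (a : X → ℕ) :
    T.partSA Set.univ a ≤ ballDeterminedSA T a := by
  refine iSup₂_le fun f _ => ?_
  rintro B ⟨S, -, rfl⟩
  refine MeasurableSpace.measurableSet_generateFrom ⟨wlen f, fun x y hxy hx => ?_⟩
  have h := hxy f le_rfl
  simp only [BorelAction.tr, mem_preimage] at hx ⊢
  rwa [← h]

theorem exists_isBallDetermined_symmDiff_le {μ : Measure X} [IsProbabilityMeasure μ]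
    (ha : Measurable a) (hgen : T.Generating a μ) {B : Set X} (hB : MeasurableSet B)
    {η : ℝ≥0∞} (hη : 0 < η) : ∃ n E, IsBallDetermined T a n E ∧ μ (E ∆ B) ≤ η := by
  obtain ⟨B', hB', hBB'⟩ := hgen B hB
  have hle : ballDeterminedSA T a ≤ mX :=
    MeasurableSpace.generateFrom_le fun B ⟨n, hB⟩ => hB.measurableSet ha
  have hB'm : MeasurableSet[ballDeterminedSA T a] B' := partSA_le_ballDeterminedSA T a _ hB'
  have hfin : IsFiniteMeasure (μ.trim hle) := isFiniteMeasure_trim hle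
  obtain ⟨E, ⟨n, hE⟩, hEB⟩ := @exists_measure_symmDiff_lt_of_generateFrom_isSetRing X
    (ballDeterminedSA T a)
    (μ.trim hle) hfin _ (isSetRing_isBallDetermined T a)
    ⟨{Set.univ}, Set.countable_singleton _, by
      rintro _ rfl
      exact ⟨0, fun _ _ _ _ => trivial⟩, by simp⟩ rfl B' hB'm η hη
  have hEm : MeasurableSet[ballDeterminedSA T a] E :=
    MeasurableSpace.measurableSet_generateFrom ⟨n, hE⟩
  rw [trim_measurableSet_eq hle (hEm.symmDiff hB'm)] at hEB
  refine ⟨n, E, hE, (measure_symmDiff_le E B' B).trans ?_⟩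
  rw [symmDiff_comm B' B, hBB', add_zero]
  exact hEB.le

end Approximation

section Stabilizers

set_option linter.unusedSectionVars false

variable {r : ℕ} {X : Type*} [MeasurableSpace X] [StandardBorelSpace X]
  {T : BorelAction (FG r) X} {μ : Measure X} [IsProbabilityMeasure μ]

theorem measurableSet_fixed (T : BorelAction (FG r) X) (g : FG r) :
    MeasurableSet {x | T.act g x = x} :=
  measurableSet_eq_fun (T.measurable_act g) measurable_id

theorem act_iterate (T : BorelAction (FG r) X) (g : FG r) (n : ℕ) :
    (T.act g)^[n] = T.act (g ^ n) := by
  induction n with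
  | zero => funext x; simp [T.act_one]
  | succ n ih => funext x; rw [Function.iterate_succ_apply', ih, pow_succ', T.act_mul]

theorem mk_replicate (q : Fin r × Bool) (n : ℕ) :
    FreeGroup.mk (List.replicate n q) = FreeGroup.mk [q] ^ n := by
  induction n with
  | zero => rfl
  | succ n ih => rw [List.replicate_succ, mk_cons, ih, pow_succ']

theorem isReduced_replicate (q : Fin r × Bool) (n : ℕ) :
    FreeGroup.IsReduced (List.replicate n q) := by
  rw [FreeGroup.IsReduced]
  exact List.isChain_replicate_of_rel n fun _ => rfl

/-- Conjugating a word by a power of a letter of a generator different from those of its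
first and last letters gives a word ending with the inverse letter. -/
theorem getLast?_toWord_conj {q : Fin r × Bool} {k : FG r} {n : ℕ} (hn : n ≠ 0)
    (hk : k ≠ 1) (hhead : ∀ c ∈ k.toWord.head?, c.1 ≠ q.1)
    (hlast : ∀ c ∈ k.toWord.getLast?, c.1 ≠ q.1) :
    (FreeGroup.mk [q] ^ n * k * (FreeGroup.mk [q] ^ n)⁻¹).toWord.getLast? =
      some (invLetter q) := by
  have hkw : k.toWord ≠ [] := by rwa [Ne, FreeGroup.toWord_eq_nil_iff]
  have hred : FreeGroup.IsReduced
      (List.replicate n q ++ (k.toWord ++ List.replicate n (invLetter q))) := by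
    refine List.isChain_append.2 ⟨isReduced_replicate q n, List.isChain_append.2
      ⟨FreeGroup.isReduced_toWord, isReduced_replicate _ n, ?_⟩, ?_⟩
    · intro x hx y hy hxy
      rw [List.head?_replicate, if_neg hn, Option.mem_some_iff] at hy
      subst hy
      exact absurd hxy (hlast x hx)
    · intro x hx y hy hxy
      rw [List.getLast?_replicate, if_neg hn, Option.mem_some_iff] at hx
      subst hx
      rw [List.head?_append_of_ne_nil _ hkw] at hy
      exact absurd hxy.symm (hhead y hy)
  have heq : FreeGroup.mk [q] ^ n * k * (FreeGroup.mk [q] ^ n)⁻¹ = FreeGroup.mk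
      (List.replicate n q ++ (k.toWord ++ List.replicate n (invLetter q))) := by
    rw [← FreeGroup.mul_mk, ← FreeGroup.mul_mk, mk_replicate, mk_replicate, mk_invLetter,
      FreeGroup.mk_toWord, inv_pow, mul_assoc]
  rw [heq, toWord_mk_of_isReduced hred, List.getLast?_append_of_ne_nil _ (by simp [hn]),
    List.getLast?_append_of_ne_nil _ (by simp [hn]), List.getLast?_replicate, if_neg hn]

theorem act_conj_eq {g k : FG r} {x : X} (h : T.act k x = x) :
    T.act (g * k * g⁻¹) (T.act g x) = T.act g x := by
  rw [← T.act_mul, inv_mul_cancel_right, T.act_mul, h]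

/-- In rank at least two, almost no point has a nontrivial stabilizer all of whose nontrivial
elements end with a given letter. -/
theorem ae_exists_fixed_getLast?_ne (hr : 2 ≤ r) (hT : T.Preserves μ) (c : Fin r × Bool) :
    ∀ᵐ x ∂μ, (∃ g, g ≠ 1 ∧ T.act g x = x) →
      ∃ g, g ≠ 1 ∧ g.toWord.getLast? ≠ some c ∧ T.act g x = x := by
  obtain ⟨i, hi⟩ : ∃ i : Fin r, i ≠ c.1 := by
    have : Nontrivial (Fin r) := Fin.nontrivial_iff_two_le.2 hr
    exact exists_ne c.1
  set Z : Set X := {x | (∃ g, g ≠ 1 ∧ T.act g x = x) ∧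
    ∀ g, g ≠ 1 → T.act g x = x → g.toWord.getLast? = some c} with hZ
  have hZm : MeasurableSet Z := by
    have h1 : Z = (⋃ g : FG r, ⋃ _ : g ≠ 1, {x | T.act g x = x}) ∩
        ⋂ g : FG r, ⋂ _ : g ≠ 1 ∧ g.toWord.getLast? ≠ some c, {x | T.act g x = x}ᶜ := by
      ext x
      simp only [hZ, mem_inter_iff, mem_iUnion, mem_iInter, mem_compl_iff, Set.mem_ofPred_eq,
        exists_prop]
      refine and_congr_right fun _ => forall_congr' fun g => ?_
      tauto
    rw [h1]
    exact (MeasurableSet.iUnion fun g => MeasurableSet.iUnion fun _ =>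
      measurableSet_fixed T g).inter (MeasurableSet.iInter fun g => MeasurableSet.iInter fun _ =>
      (measurableSet_fixed T g).compl)
  have hZ0 : μ Z = 0 := by
    by_contra hne
    set q : Fin r × Bool := (i, true)
    obtain ⟨x, hx, n, hn, hnx⟩ :=
      (hT (FreeGroup.mk [q])).exists_mem_iterate_mem hZm.nullMeasurableSet hne
    rw [act_iterate] at hnx
    obtain ⟨⟨k, hk, hkx⟩, hlast⟩ := hx
    have h1 := hlast k hk hkx
    have h2 := hlast k⁻¹ (inv_ne_one.2 hk) (by
      conv_lhs => rw [← hkx]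
      rw [← T.act_mul, inv_mul_cancel, T.act_one])
    have h3 := getLast?_toWord_conj (q := q) hn hk ?_ ?_
    · have h4 := hnx.2 _ (mt conj_eq_one_iff.1 hk) (act_conj_eq (g := FreeGroup.mk [q] ^ n) hkx)
      rw [h3, Option.some.injEq] at h4
      exact hi (congrArg Prod.fst h4)
    · intro d hd hdq
      rw [FreeGroup.toWord_inv, FreeGroup.invRev, List.getLast?_reverse, List.head?_map,
        Option.mem_def.1 hd] at h2
      have h4 := congrArg Prod.fst (Option.some.inj h2)
      exact hi (hdq.symm.trans h4)
    · intro d hd hdq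
      rw [Option.mem_def.1 hd] at h1
      have h4 := congrArg Prod.fst (Option.some.inj h1)
      exact hi (hdq.symm.trans h4)
  filter_upwards [measure_eq_zero_iff_ae_notMem.1 hZ0] with x hx hex
  by_contra! hcon
  refine hx ⟨hex, fun g hg hgx => ?_⟩
  by_contra hne
  exact hcon g hg hne hgx

/-- If almost every stabilizer is nontrivial, then a finite set of nontrivial group elements
contains, up to small measure, stabilizing elements not ending with any prescribed letter. -/
theorem exists_finset_fixed (hr : 2 ≤ r) (hT : T.Preserves μ)
    (hB : ∀ᵐ x ∂μ, ∃ g, g ≠ 1 ∧ T.act g x = x) {ε : ℝ≥0∞} (hε : 0 < ε) :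
    ∃ K : Finset (FG r), 1 ∉ K ∧ ∀ c : Fin r × Bool,
      μ {x | ∀ g ∈ K, g.toWord.getLast? ≠ some c → T.act g x ≠ x} ≤ ε := by
  let s (c : Fin r × Bool) (K : Finset (FG r)) : Set X :=
    {x | ∀ g ∈ K, g ≠ 1 → g.toWord.getLast? ≠ some c → T.act g x ≠ x}
  have hs : ∀ c K, MeasurableSet (s c K) := by
    intro c K
    have h1 : s c K = ⋂ g : FG r, ⋂ _ : g ∈ K ∧ g ≠ 1 ∧ g.toWord.getLast? ≠ some c,
        {x | T.act g x = x}ᶜ := by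
      ext x
      simp [s]
    rw [h1]
    exact MeasurableSet.iInter fun g => MeasurableSet.iInter fun _ =>
      (measurableSet_fixed T g).compl
  have hev : ∀ c, ∀ᶠ K in atTop, μ (s c K) < ε := by
    intro c
    have hanti : Antitone (s c) := fun K K' hKK' x hx g hg => hx g (hKK' hg)
    have hlim := tendsto_measure_iInter_atTop (μ := μ)
      (fun K => (hs c K).nullMeasurableSet) hanti ⟨∅, measure_ne_top _ _⟩
    have h0 : μ (⋂ K, s c K) = 0 := by
      rw [measure_eq_zero_iff_ae_notMem]
      filter_upwards [ae_exists_fixed_getLast?_ne hr hT c, hB] with x h1 h2 h3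
      obtain ⟨g, hg, hgc, hgx⟩ := h1 h2
      exact mem_iInter.1 h3 {g} g (Finset.mem_singleton_self g) hg hgc hgx
    rw [h0] at hlim
    exact hlim.eventually_lt_const hε
  obtain ⟨K, hK⟩ := (eventually_all.2 hev).exists
  refine ⟨K.erase 1, Finset.notMem_erase 1 K, fun c => ((measure_mono ?_).trans_lt (hK c)).le⟩
  intro x hx g hg hg1 hgc
  exact hx g (Finset.mem_erase.2 ⟨hg1, hg⟩) hgc

end Stabilizers

section Prediction

set_option linter.unusedSectionVars false

variable {r : ℕ} {X : Type*} [MeasurableSpace X] [StandardBorelSpace X]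
  {T : BorelAction (FG r) X} {μ : Measure X} [IsProbabilityMeasure μ] {a : X → ℕ}

theorem act_injective (T : BorelAction (FG r) X) (g : FG r) : Function.Injective (T.act g) :=
  Function.LeftInverse.injective (g := T.act g⁻¹) fun x => by
    rw [← T.act_mul, inv_mul_cancel, T.act_one]

theorem windowName_eq_iff {L : List (Fin r × Bool)} {x y : X} :
    windowName T a L x = windowName T a L y ↔ ∀ c ∈ window L,
      a (T.act c⁻¹ (T.act (FreeGroup.mk L) x)) = a (T.act c⁻¹ (T.act (FreeGroup.mk L) y)) :=
  joinF_eq_iff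

theorem measurable_windowName (ha : Measurable a) (L : List (Fin r × Bool)) :
    Measurable (windowName T a L) :=
  (measurable_joinF ha _).comp (T.measurable_act _)

theorem windowName_factorsThrough_append {M L : List (Fin r × Bool)}
    (hML : FreeGroup.IsReduced (M ++ L)) :
    (windowName T a L).FactorsThrough (windowName T a (M ++ L)) := by
  intro x y hxy
  rw [windowName_eq_iff] at hxy ⊢
  intro c hc
  have h := hxy _ (mk_mul_mem_window_append hML hc)
  simpa only [← T.act_mul, ← FreeGroup.mul_mk, mul_inv_rev, mul_assoc, inv_mul_cancel_left]
    using h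

theorem measurableSet_ne_some {L : List (Fin r × Bool)} (ha : Measurable a)
    {p : X → Option ℕ} (hp : p.FactorsThrough (windowName T a L)) :
    MeasurableSet {x | p x ≠ some (a x)} := by
  refine measurableSet_of_factorsThrough ((measurable_windowName (T := T) ha L).prodMk ha) ?_
  intro x y hxy hx
  rw [Prod.mk.injEq] at hxy
  rwa [Set.mem_ofPred_eq, ← hp hxy.1, ← hxy.2]

/-- A partial prediction of `a` may be extended using an element `l` of the group: where the
approximation `E` of the set of fixed points of `l` indicates that `l` fixes `g x`, the value
`a x` is predicted to be `a (g⁻¹ l g x)`. -/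
theorem exists_extend_prediction (hT : T.Preserves μ) (ha : Measurable a)
    {L : List (Fin r × Bool)} {p : X → Option ℕ} (hp : p.FactorsThrough (windowName T a L))
    {N : ℕ} (hN : ballFinset r N ⊆ window L) {l : FG r} (hl : l ≠ 1)
    (hred : FreeGroup.IsReduced (l.toWord ++ L)) {E : Set X} (hE : IsBallDetermined T a N E)
    {η : ℝ} (hη : μ.real (E ∆ {x | T.act l x = x}) ≤ η) :
    ∃ p' : X → Option ℕ, p'.FactorsThrough (windowName T a (l.toWord ++ L)) ∧
      μ.real {x | ∃ k, p' x = some k ∧ k ≠ a x} ≤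
        μ.real {x | ∃ k, p x = some k ∧ k ≠ a x} + η ∧
      μ.real {x | p' x = none} ≤ μ.real ({x | p x = none} \
        {x | T.act l (T.act (FreeGroup.mk L) x) = T.act (FreeGroup.mk L) x}) + η := by
  classical
  set g : FG r := FreeGroup.mk L
  have hword : l.toWord ≠ [] := by rwa [Ne, FreeGroup.toWord_eq_nil_iff]
  have hmk : FreeGroup.mk (l.toWord ++ L) = l * g := by
    rw [← FreeGroup.mul_mk, FreeGroup.mk_toWord]
  let p' : X → Option ℕ := fun x => (p x).orElse fun _ =>
    if T.act (l * g) x ∈ E then some (a (T.act g⁻¹ (T.act (l * g) x))) else none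
  have hsome : ∀ x k, p x = some k → p' x = some k := fun x k h => by simp [p', h]
  have hnone : ∀ x, p x = none → p' x =
      if T.act (l * g) x ∈ E then some (a (T.act g⁻¹ (T.act (l * g) x))) else none :=
    fun x h => by simp [p', h]
  have hbound : ∀ B C : Set X, C ⊆ B ∪ T.act (l * g) ⁻¹' (E ∆ {x | T.act l x = x}) →
      μ.real C ≤ μ.real B + η := by
    intro B C hC
    refine (measureReal_mono hC).trans ((measureReal_union_le _ _).trans ?_)
    rw [(hT (l * g)).measureReal_preimage
      ((hE.measurableSet ha).symmDiff (measurableSet_fixed T l)).nullMeasurableSet]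
    gcongr
  refine ⟨p', ?_, hbound _ _ ?_, hbound _ _ ?_⟩
  · intro x y hxy
    have h1 : p x = p y := hp (windowName_factorsThrough_append hred hxy)
    rw [windowName_eq_iff, hmk] at hxy
    have h2 : a (T.act g⁻¹ (T.act (l * g) x)) = a (T.act g⁻¹ (T.act (l * g) y)) :=
      hxy g (mk_mem_window_append hword L)
    have hball : ∀ f, wlen f ≤ N →
        a (T.act f⁻¹ (T.act (l * g) x)) = a (T.act f⁻¹ (T.act (l * g) y)) :=
      fun f hf => hxy f (window_subset_append _ _ (hN (mem_ballFinset.2 hf)))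
    have h3 : T.act (l * g) x ∈ E ↔ T.act (l * g) y ∈ E :=
      ⟨hE _ _ hball, hE _ _ fun f hf => (hball f hf).symm⟩
    simp only [p', h1, h2, h3]
  · rintro x ⟨k, hk, hka⟩
    rcases hpx : p x with _ | k'
    · right
      rw [hnone x hpx] at hk
      split_ifs at hk with hxE
      refine Or.inl ⟨hxE, fun hfix => hka ?_⟩
      have h1 : T.act (l * g) x = T.act g x := by
        refine act_injective T l ?_
        rw [← T.act_mul l g x]
        exact hfix
      rw [h1, ← T.act_mul, inv_mul_cancel, T.act_one] at hk
      exact (Option.some.inj hk).symm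
    · exact Or.inl ⟨k, by rw [hpx, ← hk, hsome x k' hpx], hka⟩
  · intro x hx
    have hpx : p x = none := by
      rcases hpx : p x with _ | k
      · rfl
      · rw [Set.mem_ofPred_eq, hsome x k hpx] at hx
        cases hx
    rw [Set.mem_ofPred_eq, hnone x hpx] at hx
    have hxE : T.act (l * g) x ∉ E := fun h => by simp [h] at hx
    by_cases hfix : T.act l (T.act g x) = T.act g x
    · refine Or.inr (Or.inr ⟨?_, hxE⟩)
      rw [Set.mem_ofPred_eq, T.act_mul l g x, hfix, hfix]
    · exact Or.inl ⟨hpx, hfix⟩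

theorem isReduced_toWord_append {l : FG r} {s : Fin r × Bool} {L : List (Fin r × Bool)}
    (hL : FreeGroup.IsReduced (s :: L)) (hl : l.toWord.getLast? ≠ some (invLetter s)) :
    FreeGroup.IsReduced (l.toWord ++ s :: L) := by
  refine List.isChain_append.2 ⟨FreeGroup.isReduced_toWord, hL, ?_⟩
  intro x hx y hy hxy
  rw [List.head?_cons, Option.mem_some_iff] at hy
  subst hy
  by_contra hne
  refine hl ((Option.mem_def.1 hx).trans (congrArg some (Prod.ext hxy ?_)))
  simp only [invLetter]
  cases h1 : x.2 <;> cases h2 : s.2 <;> simp_all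

/-- If a set has measure more than `2 ε` and all but `ε` of the space is covered by finitely many
sets, then one of these meets the set in measure at least `ε` divided by their number. -/
theorem exists_le_measureReal_inter {ι : Type*} {s : Finset ι} {A Z : Set X} {B : ι → Set X}
    {ε P : ℝ} (hP : (s.card : ℝ) < P) (hε : 0 < ε) (hA : 2 * ε < μ.real A) (hZ : μ.real Z ≤ ε)
    (hcov : A ⊆ Z ∪ ⋃ i ∈ s, B i) : ∃ i ∈ s, ε / P ≤ μ.real (A ∩ B i) := by
  by_contra! hcon
  have hP0 : 0 < P := (Nat.cast_nonneg _).trans_lt hP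
  have h1 : A ⊆ Z ∪ ⋃ i ∈ s, A ∩ B i := by
    intro x hx
    rcases hcov hx with h | h
    · exact Or.inl h
    · simp only [mem_iUnion, exists_prop] at h
      obtain ⟨i, hi, hxi⟩ := h
      exact Or.inr (mem_biUnion hi ⟨hx, hxi⟩)
  have h2 : μ.real (⋃ i ∈ s, A ∩ B i) ≤ ∑ i ∈ s, μ.real (A ∩ B i) :=
    measureReal_biUnion_finset_le s _
  have h3 : ∑ i ∈ s, μ.real (A ∩ B i) ≤ s.card * (ε / P) := by
    rw [← nsmul_eq_mul]
    exact Finset.sum_le_card_nsmul s _ _ fun i hi => (hcon i hi).le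
  have h4 : s.card * (ε / P) ≤ ε := by
    rw [mul_div_assoc', div_le_iff₀ hP0, mul_comm]
    gcongr
  have h5 := (measureReal_mono h1).trans (measureReal_union_le (μ := μ) _ _)
  linarith

theorem exists_prediction (hr : 2 ≤ r) (hT : T.Preserves μ) (ha : Measurable a)
    (hgen : T.Generating a μ) (hB : ∀ᵐ x ∂μ, ∃ g, g ≠ 1 ∧ T.act g x = x) {ε : ℝ} (hε : 0 < ε) :
    ∃ (L : List (Fin r × Bool)) (p : X → Option ℕ), FreeGroup.IsReduced L ∧
      p.FactorsThrough (windowName T a L) ∧ μ.real {x | p x ≠ some (a x)} ≤ 3 * ε := by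
  obtain ⟨K, hK1, hK⟩ := exists_finset_fixed hr hT hB (ENNReal.ofReal_pos.2 hε)
  set P : ℝ := K.card + 1 with hP
  have hP0 : 0 < P := by positivity
  obtain ⟨J, hJ⟩ := exists_nat_ge (2 * P / ε)
  rw [div_le_iff₀ hε] at hJ
  obtain ⟨η, hη0, hηP, hηJ⟩ : ∃ η : ℝ, 0 < η ∧ η ≤ ε / P / 2 ∧ J * η ≤ ε := by
    refine ⟨min (ε / P / 2) (ε / (J + 1)), by positivity, min_le_left _ _, ?_⟩
    calc J * min (ε / P / 2) (ε / (J + 1)) ≤ (J + 1) * (ε / (J + 1)) := by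
          gcongr
          · linarith
          · exact min_le_right _ _
      _ = ε := by field_simp
  choose n E hE hEη using fun l : FG r => exists_isBallDetermined_symmDiff_le (μ := μ) ha hgen
    (measurableSet_fixed T l) (ENNReal.ofReal_pos.2 hη0)
  have hEη' : ∀ l, μ.real (E l ∆ {x | T.act l x = x}) ≤ η := fun l =>
    ENNReal.toReal_le_of_le_ofReal hη0.le (hEη l)
  set N := K.sup n
  have key : ∀ j : ℕ, ∃ (L : List (Fin r × Bool)) (p : X → Option ℕ), FreeGroup.IsReduced L ∧
      L ≠ [] ∧ ballFinset r N ⊆ window L ∧ p.FactorsThrough (windowName T a L) ∧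
      μ.real {x | ∃ k, p x = some k ∧ k ≠ a x} ≤ j * η ∧
      (μ.real {x | p x = none} ≤ 2 * ε ∨ μ.real {x | p x = none} ≤ 1 - j * (ε / P / 2)) := by
    intro j
    induction j with
    | zero =>
      have hpq : ((⟨0, by omega⟩, true) : Fin r × Bool).1 ≠
          ((⟨1, by omega⟩, true) : Fin r × Bool).1 := by simp
      obtain ⟨L, hL⟩ := altWord_ne_nil ((⟨0, by omega⟩, true) : Fin r × Bool)
        (⟨1, by omega⟩, true) N
      refine ⟨_, fun _ => none, isReduced_altWord hpq N, by simp [hL],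
        ballFinset_subset_window_altWord hpq N, fun _ _ _ => rfl, by simp, by simp⟩
    | succ j ih =>
      obtain ⟨L, p, hL, hL0, hN, hp, herr, hnone⟩ := ih
      by_cases hbig : μ.real {x | p x = none} ≤ 2 * ε
      · refine ⟨L, p, hL, hL0, hN, hp, herr.trans ?_, Or.inl hbig⟩
        gcongr
        simp
      obtain ⟨s, L, rfl⟩ := List.exists_cons_of_ne_nil hL0
      set g : FG r := FreeGroup.mk (s :: L) with hg
      have hZ : μ.real {x | ∀ l ∈ K, l.toWord.getLast? ≠ some (invLetter s) →
          T.act l (T.act g x) ≠ T.act g x} ≤ ε := by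
        refine ENNReal.toReal_le_of_le_ofReal hε.le (le_trans (le_of_eq ?_) (hK (invLetter s)))
        refine (hT g).measure_preimage (MeasurableSet.nullMeasurableSet ?_) (s :=
          {x | ∀ l ∈ K, l.toWord.getLast? ≠ some (invLetter s) → T.act l x ≠ x})
        have h1 : {x | ∀ l ∈ K, l.toWord.getLast? ≠ some (invLetter s) → T.act l x ≠ x} =
            ⋂ l : FG r, ⋂ _ : l ∈ K ∧ l.toWord.getLast? ≠ some (invLetter s),
              {x | T.act l x = x}ᶜ := by
          ext x
          simp
        rw [h1]
        exact MeasurableSet.iInter fun l => MeasurableSet.iInter fun _ =>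
          (measurableSet_fixed T l).compl
      obtain ⟨l, hlK, hl⟩ := exists_le_measureReal_inter (μ := μ)
        (s := K.filter fun l => l.toWord.getLast? ≠ some (invLetter s))
        (B := fun l => {x | T.act l (T.act g x) = T.act g x}) (P := P)
        (lt_of_le_of_lt (Nat.cast_le.2 (Finset.card_filter_le _ _)) (lt_add_one _))
        hε (not_le.1 hbig) hZ (by
          intro x _
          by_cases hx : ∀ l ∈ K, l.toWord.getLast? ≠ some (invLetter s) →
            T.act l (T.act g x) ≠ T.act g x
          · exact Or.inl hx
          · push Not at hx
            obtain ⟨l, h1, h2, h3⟩ := hx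
            exact Or.inr (mem_biUnion (Finset.mem_filter.2 ⟨h1, h2⟩) h3))
      rw [Finset.mem_filter] at hlK
      have hl1 : l ≠ 1 := fun h => hK1 (h ▸ hlK.1)
      have hred := isReduced_toWord_append hL hlK.2
      obtain ⟨p', hp', herr', hnone'⟩ := exists_extend_prediction hT ha hp hN hl1 hred
        ((hE l).mono (Finset.le_sup hlK.1)) (hEη' l)
      refine ⟨_, p', hred, by simp, hN.trans (window_subset_append _ _), hp', ?_, Or.inr ?_⟩
      · push_cast
        linarith
      · have hsplit := measureReal_inter_add_sdiff (μ := μ) (s := {x | p x = none})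
          ((measurableSet_fixed T l).preimage (T.measurable_act g))
        have h1 := hnone.resolve_left hbig
        have h2 : μ.real ({x | p x = none} ∩ {x | T.act l (T.act g x) = T.act g x}) +
          μ.real ({x | p x = none} \ {x | T.act l (T.act g x) = T.act g x}) =
          μ.real {x | p x = none} := hsplit
        push_cast
        linarith
  obtain ⟨L, p, hL, -, -, hp, herr, hnone⟩ := key J
  refine ⟨L, p, hL, hp, ?_⟩
  have hnone' : μ.real {x | p x = none} ≤ 2 * ε := by
    refine hnone.elim id fun h => h.trans ?_
    have : 1 ≤ J * (ε / P / 2) := by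
      rw [div_div, mul_div_assoc', le_div_iff₀ (by positivity)]
      linarith
    linarith
  have hsub : {x | p x ≠ some (a x)} ⊆ {x | ∃ k, p x = some k ∧ k ≠ a x} ∪ {x | p x = none} := by
    intro x hx
    rcases hpx : p x with _ | k
    · exact Or.inr hpx
    · exact Or.inl ⟨k, hpx, fun h => hx (by rw [hpx, h])⟩
  have := (measureReal_mono hsub).trans (measureReal_union_le (μ := μ) _ _)
  linarith

theorem fInv_nonpos_of_two_le (hr : 2 ≤ r) (hT : T.Preserves μ) (ha : Measurable a)
    (hgen : T.Generating a μ) (hfin : Hpart μ a < ⊤)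
    (hB : ∀ᵐ x ∂μ, ∃ g, g ≠ 1 ∧ T.act g x = x) : fInv μ T a ≤ 0 := by
  refine fInv_nonpos_of_predictable hT ha hfin fun ε hε => ?_
  obtain ⟨δ, hδ, hδε⟩ := ENNReal.lt_iff_exists_nnreal_btwn.1 hε
  have hδ0 : (0 : ℝ) < δ / 3 := by
    have : 0 < δ := ENNReal.coe_pos.1 hδ
    positivity
  obtain ⟨L, p, hL, hp, h⟩ := exists_prediction hr hT ha hgen hB hδ0
  refine ⟨L, p, hL, hp, measurableSet_ne_some ha hp, le_trans ?_ hδε.le⟩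
  rw [← ENNReal.ofReal_toReal (measure_ne_top μ {x | p x ≠ some (a x)}),
    ← ENNReal.ofReal_coe_nnreal]
  refine ENNReal.ofReal_le_ofReal (h.trans (by linarith))

theorem fInv_nonpos_of_ae_fixed (hT : T.Preserves μ) (ha : Measurable a) (hfin : Hpart μ a < ⊤)
    {g : FG r} (hg : g ≠ 1) (hfix : ∀ᵐ x ∂μ, T.act g x = x) : fInv μ T a ≤ 0 := by
  refine fInv_nonpos_of_predictable hT ha hfin fun ε _ => ?_
  have hword : g.toWord ≠ [] := by rwa [Ne, FreeGroup.toWord_eq_nil_iff]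
  have hp : (fun x => some (a (T.act g x))).FactorsThrough (windowName T a g.toWord) := by
    intro x y hxy
    have h := windowName_eq_iff.1 hxy 1 (one_mem_window hword)
    rw [FreeGroup.mk_toWord, inv_one, T.act_one, T.act_one] at h
    exact congrArg some h
  refine ⟨g.toWord, _, FreeGroup.isReduced_toWord, hp, measurableSet_ne_some ha hp, ?_⟩
  refine le_of_eq_of_le (measure_eq_zero_iff_ae_notMem.2 ?_) zero_le
  filter_upwards [hfix] with x hx
  simp [hx]

theorem exists_ae_fixed_of_rank_one {T : BorelAction (FG 1) X} (herg : T.IsErgodic μ)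
    (hB : ∀ᵐ x ∂μ, ∃ g, g ≠ 1 ∧ T.act g x = x) : ∃ g, g ≠ 1 ∧ ∀ᵐ x ∂μ, T.act g x = x := by
  have hcomm : ∀ g h : FG 1, g * h = h * g := fun g h =>
    (FreeGroup.mulEquivIntOfUnique (α := Fin 1)).injective (by simp [mul_comm])
  by_contra! hcon
  have hnull : ∀ g : FG 1, g ≠ 1 → μ {x | T.act g x = x} = 0 := by
    intro g hg
    refine (herg _ (measurableSet_fixed T g) fun h => ?_).resolve_right fun h1 => hcon g hg ?_
    · have : T.smulSet h {x | T.act g x = x} = {x | T.act g x = x} := by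
        ext x
        simp only [BorelAction.smulSet, mem_preimage, Set.mem_ofPred_eq]
        rw [← T.act_mul, hcomm, T.act_mul]
        exact (act_injective T h⁻¹).eq_iff
      rw [this, symmDiff_self]
      exact measure_empty
    · filter_upwards [(mem_ae_iff_prob_eq_one (measurableSet_fixed T g)).2 h1] with x hx
      exact not_not.2 hx
  have hae : ∀ᵐ x ∂μ, ∀ g : FG 1, g ≠ 1 → T.act g x ≠ x := by
    rw [ae_all_iff]
    intro g
    by_cases hg : g = 1
    · simp [hg]
    · filter_upwards [measure_eq_zero_iff_ae_notMem.1 (hnull g hg)] with x hx _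
      exact hx
  obtain ⟨x, h1, g, hg, h2⟩ := (hae.and hB).exists
  exact h1 g hg h2

theorem essentiallyFree_or_ae_fixed (herg : T.IsErgodic μ) :
    T.EssentiallyFree μ ∨ ∀ᵐ x ∂μ, ∃ g, g ≠ 1 ∧ T.act g x = x := by
  have hm : MeasurableSet {x | ∃ g, g ≠ 1 ∧ T.act g x = x} := by
    have : {x | ∃ g, g ≠ 1 ∧ T.act g x = x} = ⋃ g : FG r, ⋃ _ : g ≠ 1, {x | T.act g x = x} := by
      ext x
      simp
    rw [this]
    exact MeasurableSet.iUnion fun g => MeasurableSet.iUnion fun _ => measurableSet_fixed T g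
  have hinv : ∀ h : FG r, T.smulSet h {x | ∃ g, g ≠ 1 ∧ T.act g x = x} =
      {x | ∃ g, g ≠ 1 ∧ T.act g x = x} := by
    intro h
    ext x
    simp only [BorelAction.smulSet, mem_preimage, Set.mem_ofPred_eq]
    constructor
    · rintro ⟨k, hk, hkx⟩
      refine ⟨h * k * h⁻¹, mt conj_eq_one_iff.1 hk, ?_⟩
      have := act_conj_eq (g := h) hkx
      rwa [← T.act_mul h h⁻¹ x, mul_inv_cancel, T.act_one] at this
    · rintro ⟨k, hk, hkx⟩
      exact ⟨_, mt conj_eq_one_iff.1 hk, act_conj_eq (g := h⁻¹) hkx⟩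
  rcases herg _ hm (fun h => by rw [hinv, symmDiff_self]; exact measure_empty) with h | h
  · left
    rw [← prob_compl_eq_one_iff hm] at h
    rw [BorelAction.EssentiallyFree, ← h]
    congr 1
    ext x
    simp
  · exact Or.inr ((mem_ae_iff_prob_eq_one hm).2 h)

end Prediction

/-- An ergodic action with positive f-invariant entropy is essentially free. -/
theorem statement1 {r : ℕ} (hr : 1 ≤ r) {X : Type*}
    [mX : MeasurableSpace X] [StandardBorelSpace X]
    (μ : Measure X) [IsProbabilityMeasure μ]
    (T : BorelAction (FG r) X) (hT : T.Preserves μ)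
    (herg : T.IsErgodic μ)
    (hdef : ∃ a : X → ℕ, Measurable a ∧ T.Generating a μ ∧ Hpart μ a < ⊤ ∧
      0 < fInv μ T a) :
    T.EssentiallyFree μ := by
  obtain ⟨a, ha, hgen, hfin, hpos⟩ := hdef
  refine (essentiallyFree_or_ae_fixed herg).resolve_right fun hB => hpos.not_ge ?_
  rcases hr.eq_or_lt with rfl | hr
  · obtain ⟨g, hg, hfix⟩ := exists_ae_fixed_of_rank_one herg hB
    exact fInv_nonpos_of_ae_fixed hT ha hfin hg hfix
  · exact fInv_nonpos_of_two_le hr hT ha hgen hfin hB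

end FPaper
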